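/- Let Δ be the tetrahedral group [3,5,3]⁺ and let p be a prime with p ≡ ±1 (mod 5) and p ≡ 2, 6, 7, 8 or 10 (mod 11). Then Δ has exactly two normal subgroups K with Δ/K isomorphic to PSL(2, F_p) and exactly one normal subgroup K with Δ/K isomorphic to PSL(2, F_{p²}). -/

import Mathlib

/-- The relators of the tetrahedral group `Δ = [3,5,3]⁺`, on generators
`α = of 0`, `β = of 1`, `γ = of 2`. -/
def tetRelators : Set (FreeGroup (Fin 3)) :=
  { FreeGroup.of 0 ^ 3, FreeGroup.of 1 ^ 5, FreeGroup.of 2 ^ 3,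
    (FreeGroup.of 0 * FreeGroup.of 1) ^ 2, (FreeGroup.of 1 * FreeGroup.of 2) ^ 2,
    (FreeGroup.of 0 * FreeGroup.of 1 * FreeGroup.of 2) ^ 2 }

/-- The tetrahedral group `Δ = [3,5,3]⁺` as a presented group. -/
abbrev Tet : Type := PresentedGroup tetRelators

/-- `K` is a normal subgroup of `Δ` with `Δ/K ≅ PSL(2, F)`. -/
def IsPSLQuotient (F : Type) [Field F] (K : Subgroup Tet) : Prop :=
  ∃ f : Tet →* Matrix.ProjectiveSpecialLinearGroup (Fin 2) F,
    Function.Surjective f ∧ f.ker = K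

open scoped MatrixGroups

open MulAction in
/-- Burnside's orbit count for a finite group whose elements have two fixed points, except for the
two elements of `Z`, which act trivially, and those of `P`, which have one fixed point. -/
theorem orbit_sum_of_finite {G X : Type*} [Group G] [Finite G] [MulAction G X] [Fintype X]
    [Fintype (orbitRel.Quotient G X)]
    (Z : Subgroup G) (P : Set G) (hZ : ∀ z ∈ Z, ∀ x : X, z • x = x) (hZc : Nat.card Z = 2)
    (hd : ∀ g ∈ P, g ∉ Z) (hP : ∀ g ∈ P, (fixedBy X g).ncard = 1)
    (h2 : ∀ g ∉ Z, g ∉ P → (fixedBy X g).ncard = 2) :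
    ∑ ω : orbitRel.Quotient G X, (1 - 2 / (Nat.card (stabilizer G ω.out) : ℚ))
      + P.ncard / (Nat.card G : ℚ) = 2 - 4 / (Nat.card G : ℚ) := by
  classical
  have := Fintype.ofFinite G
  have hG : (Nat.card G : ℚ) ≠ 0 := by exact_mod_cast Nat.card_pos.ne'
  have hB := sum_card_fixedBy_eq_card_orbits_mul_card_group G X
  have hf : ∀ g : G, (Fintype.card (fixedBy X g) : ℚ) =
      2 + (if g ∈ Z then (Fintype.card X - 2 : ℚ) else 0) - (if g ∈ P then 1 else 0) := by
    intro g
    rw [← Nat.card_eq_fintype_card, Nat.card_coe_set_eq]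
    by_cases hz : g ∈ Z
    · have hgP : g ∉ P := fun h => hd g h hz
      have : fixedBy X g = Set.univ := by
        ext x; simpa using hZ g hz x
      rw [this, Set.ncard_univ, Nat.card_eq_fintype_card]
      simp [hz, hgP]
    · by_cases hp : g ∈ P
      · rw [hP g hp]; simp [hz, hp]; norm_num
      · rw [h2 g hz hp]; simp [hz, hp]
  have hsZ : ∑ g : G, (if g ∈ Z then (Fintype.card X - 2 : ℚ) else 0)
      = 2 * (Fintype.card X - 2) := by
    rw [← Finset.sum_filter, Finset.sum_const, nsmul_eq_mul]
    congr 1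
    rw [← Nat.cast_ofNat, ← hZc, Nat.card_eq_fintype_card, Fintype.card_subtype]
  have hsP : ∑ g : G, (if g ∈ P then (1 : ℚ) else 0) = P.ncard := by
    rw [← Finset.sum_filter, Finset.sum_const, nsmul_eq_mul, mul_one, Set.ncard_eq_toFinset_card']
    congr 2
    ext; simp
  have hX : (Fintype.card X : ℚ) =
      ∑ ω : orbitRel.Quotient G X, (Nat.card G : ℚ) / Nat.card (stabilizer G ω.out) := by
    rw [Fintype.card_congr (selfEquivSigmaOrbits G X), Fintype.card_sigma, Nat.cast_sum]
    refine Finset.sum_congr rfl fun ω _ => ?_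
    have hs : (Nat.card (stabilizer G ω.out) : ℚ) ≠ 0 := by exact_mod_cast Nat.card_pos.ne'
    rw [eq_div_iff hs]
    have := card_orbit_mul_card_stabilizer_eq_card_group G ω.out
    rw [← Nat.card_eq_fintype_card, ← Nat.card_eq_fintype_card, ← Nat.card_eq_fintype_card] at this
    rw [← Nat.card_eq_fintype_card]
    exact_mod_cast this
  have hB' : ∑ g : G, (Fintype.card (fixedBy X g) : ℚ) =
      Fintype.card (orbitRel.Quotient G X) * Nat.card G := by
    rw [Nat.card_eq_fintype_card]
    convert congrArg (Nat.cast : ℕ → ℚ) hB using 1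
    · push_cast; rfl
    · push_cast; rfl
  simp_rw [hf] at hB'
  rw [Finset.sum_sub_distrib, Finset.sum_add_distrib, hsZ, hsP, Finset.sum_const, nsmul_eq_mul,
    Finset.card_univ, ← Nat.card_eq_fintype_card (α := G)] at hB'
  have hX' : (Fintype.card X : ℚ) = Nat.card G *
      ∑ ω : orbitRel.Quotient G X, 1 / (Nat.card (stabilizer G ω.out) : ℚ) := by
    rw [hX, Finset.mul_sum]
    exact Finset.sum_congr rfl fun ω _ => by ring
  have e : ∑ ω : orbitRel.Quotient G X, (1 - 2 / (Nat.card (stabilizer G ω.out) : ℚ)) =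
      Fintype.card (orbitRel.Quotient G X) - 2 * (Fintype.card X / Nat.card G : ℚ) := by
    rw [Finset.sum_sub_distrib, Finset.sum_const, nsmul_eq_mul, Finset.card_univ, mul_one, hX',
      mul_div_cancel_left₀ _ hG, Finset.mul_sum]
    congr 1
    exact Finset.sum_congr rfl fun ω _ => by ring
  rw [e]
  field_simp
  linarith

open MulAction in
/-- The orbit count `orbit_sum_of_finite` on the set of points with nontrivial stabilizer. -/
theorem exists_orbit_representatives {G X : Type*} [Group G] [Finite G] [MulAction G X]
    (Z : Subgroup G) [Z.Normal] (P : Set G) (hZ : ∀ z ∈ Z, ∀ x : X, z • x = x)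
    (hZc : Nat.card Z = 2)
    (hd : ∀ g ∈ P, g ∉ Z) (hP : ∀ g ∈ P, (fixedBy X g).ncard = 1)
    (h2 : ∀ g ∉ Z, g ∉ P → (fixedBy X g).ncard = 2) :
    ∃ (n : ℕ) (x : Fin n → X), (∀ i, ∃ g ∉ Z, g • x i = x i) ∧
      (∀ y, (∃ g ∉ Z, g • y = y) → ∃ i, y ∈ orbit G (x i)) ∧
      (∀ i j, x i ∈ orbit G (x j) → i = j) ∧
      ∑ i, (1 - 2 / (Nat.card (stabilizer G (x i)) : ℚ))
        + P.ncard / (Nat.card G : ℚ) = 2 - 4 / (Nat.card G : ℚ) := by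
  classical
  let Ω : SubMulAction G X :=
    { carrier := {y | ∃ g ∉ Z, g • y = y}
      smul_mem' := by
        rintro h y ⟨g, hg, hy⟩
        refine ⟨h * g * h⁻¹, fun hm => hg ?_, by simp [mul_smul, hy]⟩
        have := Subgroup.Normal.conj_mem ‹Z.Normal› _ hm h⁻¹
        simpa [mul_assoc] using this }
  have hfix : ∀ g ∉ Z, (fixedBy X g).Finite := by
    intro g hg
    by_cases hp : g ∈ P
    · exact Set.finite_of_ncard_ne_zero (by rw [hP g hp]; norm_num)
    · exact Set.finite_of_ncard_ne_zero (by rw [h2 g hg hp]; norm_num)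
  have hfin : (Ω : Set X).Finite := by
    have : (Ω : Set X) = ⋃ g ∈ {g : G | g ∉ Z}, fixedBy X g := by
      ext y
      simp only [Set.mem_iUnion, Set.mem_ofPred_eq, mem_fixedBy, exists_prop]
      rfl
    rw [this]
    exact Set.Finite.biUnion (Set.toFinite _) hfix
  have : Fintype Ω := hfin.fintype
  have hcard : ∀ g ∉ Z, (fixedBy Ω g).ncard = (fixedBy X g).ncard := by
    intro g hg
    rw [← Set.ncard_image_of_injective _ (Subtype.val_injective : Function.Injective
      (Subtype.val : Ω → X))]
    congr 1
    ext y
    constructor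
    · rintro ⟨y, hy, rfl⟩
      exact congrArg Subtype.val hy
    · intro hy
      exact ⟨⟨y, g, hg, hy⟩, Subtype.ext hy, rfl⟩
  have : Fintype (orbitRel.Quotient G Ω) := Fintype.ofFinite _
  have key := orbit_sum_of_finite (X := Ω) Z P (fun z hz x => Subtype.ext (hZ z hz x)) hZc hd
    (fun g hg => (hcard g (hd g hg)).trans (hP g hg))
    (fun g hg hg' => (hcard g hg).trans (h2 g hg hg'))
  let e := Fintype.equivFin (orbitRel.Quotient G Ω)
  refine ⟨_, fun i => ((e.symm i).out : Ω), fun i => (e.symm i).out.2, ?_, ?_, ?_⟩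
  · rintro y hy
    refine ⟨e (Quotient.mk _ ⟨y, hy⟩), ?_⟩
    simp only [Equiv.symm_apply_apply]
    have : (⟨y, hy⟩ : Ω) ∈ orbit G (Quotient.out (Quotient.mk (orbitRel G Ω) ⟨y, hy⟩)) := by
      rw [← orbitRel_apply]
      exact Setoid.symm' _ (Quotient.mk_out (s := orbitRel G Ω) _)
    exact SubMulAction.mem_orbit_subMul_iff.1 this
  · intro i j hij
    have h := SubMulAction.mem_orbit_subMul_iff.2 hij
    rw [← orbitRel_apply] at h
    have h' := Quotient.out_equiv_out.1 h
    exact e.symm.injective h'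
  · rw [← key, ← Equiv.sum_comp e]
    simp_rw [Equiv.symm_apply_apply, ← SubMulAction.stabilizer_of_subMul]

/-- The signatures of the finite rotation groups: the sum below forces the icosahedral one, unless
some `t i` is at least half of the group order `g`. -/
theorem signature_of_orbit_sum {n g : ℕ} {t : Fin n → ℕ} (ht : ∀ i, 2 ≤ t i) (hg : ∀ i, t i ≤ g)
    (h30 : 30 ≤ g) (h : ∑ i, (1 - 1 / (t i : ℚ)) = 2 - 2 / (g : ℚ)) :
    (∃ i, g ≤ 2 * t i) ∨ ∀ i, t i = 2 ∨ t i = 3 ∨ t i = 5 := by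
  have hg0 : (30 : ℚ) ≤ g := by exact_mod_cast h30
  have hgi : (2 : ℚ) / g ≤ 1 / 15 := by
    rw [div_le_div_iff₀ (by linarith) (by norm_num)]; linarith
  have hgp : (0 : ℚ) < 2 / g := by positivity
  have hi : ∀ i, (1 : ℚ) / 2 ≤ 1 - 1 / (t i : ℚ) := by
    intro i
    have : (2 : ℚ) ≤ t i := by exact_mod_cast ht i
    have : (1 : ℚ) / t i ≤ 1 / 2 := one_div_le_one_div_of_le (by norm_num) this
    linarith
  have hn : n ≤ 3 := by
    by_contra hn
    have : ∑ i : Fin n, (1 : ℚ) / 2 ≤ ∑ i, (1 - 1 / (t i : ℚ)) := Finset.sum_le_sum fun i _ => hi i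
    rw [h, Finset.sum_const, nsmul_eq_mul, Finset.card_univ, Fintype.card_fin] at this
    have h4 : (4 : ℚ) ≤ n := by exact_mod_cast (by omega : 4 ≤ n)
    linarith
  by_contra hcon
  push Not at hcon
  obtain ⟨h2, j, hj⟩ := hcon
  have hlt : ∀ i, (2 : ℚ) / g < 1 / t i / 1 ∧ 4 / (g : ℚ) < 2 / g + 1 / t i := by
    intro i
    have h1 : (0 : ℚ) < t i := by exact_mod_cast (by have := ht i; omega : 0 < t i)
    have h2' : (2 : ℚ) * t i < g := by exact_mod_cast h2 i
    have h3 : (2 : ℚ) / g < 1 / t i := by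
      rw [div_lt_div_iff₀ (by linarith) h1]; linarith
    have : (4 : ℚ) / g = 2 / g + 2 / g := by ring
    exact ⟨by simpa using h3, by linarith⟩
  have hup : ∀ i, 1 - 1 / (t i : ℚ) < 1 := by
    intro i
    have h1 : (0 : ℚ) < t i := by exact_mod_cast (by have := ht i; omega : 0 < t i)
    have : (0 : ℚ) < 1 / t i := by positivity
    linarith
  interval_cases n
  · simp at h; linarith
  · rw [Fin.sum_univ_one] at h
    have := hup 0
    linarith
  · rw [Fin.sum_univ_two] at h
    have := (hlt 0).1
    have := (hlt 1).1
    simp only [div_one] at *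
    linarith
  · rw [Fin.sum_univ_three] at h
    have key : ∀ a b c : ℕ, a ≤ b → b ≤ c → 2 ≤ a → 2 * c < g →
        1 - 1 / (a : ℚ) + (1 - 1 / (b : ℚ)) + (1 - 1 / (c : ℚ)) = 2 - 2 / (g : ℚ) →
        a = 2 ∧ b = 3 ∧ c = 5 := by
      intro a b c hab hbc ha hc he
      have ha' : (2 : ℚ) ≤ a := by exact_mod_cast ha
      have hab' : (a : ℚ) ≤ b := by exact_mod_cast hab
      have hbc' : (b : ℚ) ≤ c := by exact_mod_cast hbc
      have e1 : (1 : ℚ) / b ≤ 1 / a := one_div_le_one_div_of_le (by linarith) hab'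
      have e2 : (1 : ℚ) / c ≤ 1 / b := one_div_le_one_div_of_le (by linarith) hbc'
      have a3 : a < 3 := by
        by_contra hh
        have : (3 : ℚ) ≤ a := by exact_mod_cast not_lt.1 hh
        have : (1 : ℚ) / a ≤ 1 / 3 := one_div_le_one_div_of_le (by norm_num) this
        linarith
      obtain rfl : a = 2 := by omega
      have b4 : b < 4 := by
        by_contra hh
        have : (4 : ℚ) ≤ b := by exact_mod_cast not_lt.1 hh
        have : (1 : ℚ) / b ≤ 1 / 4 := one_div_le_one_div_of_le (by norm_num) this
        push_cast at he
        linarith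
      have c3 : (2 : ℚ) / g < 1 / c := by
        rw [div_lt_div_iff₀ (by linarith) (by linarith)]
        have : (2 : ℚ) * c < g := by exact_mod_cast hc
        linarith
      have b2 : b ≠ 2 := by
        rintro rfl
        push_cast at he
        linarith
      obtain rfl : b = 3 := by omega
      have c6 : c < 6 := by
        by_contra hh
        have : (6 : ℚ) ≤ c := by exact_mod_cast not_lt.1 hh
        have : (1 : ℚ) / c ≤ 1 / 6 := one_div_le_one_div_of_le (by norm_num) this
        push_cast at he
        linarith
      refine ⟨rfl, rfl, ?_⟩
      have : 3 ≤ c := hbc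
      interval_cases c
      · push_cast at he; linarith
      · push_cast at he; linarith
      · rfl
    have h0 := h2 0
    have h1 := h2 1
    have h3 := h2 2
    have t0 := ht 0
    have t1 := ht 1
    have t2 := ht 2
    have hall : ∀ i, t i = 2 ∨ t i = 3 ∨ t i = 5 := by
      rw [Fin.forall_fin_succ, Fin.forall_fin_two]
      simp only [Fin.succ_zero_eq_one, Fin.succ_one_eq_two]
      rcases le_total (t 0) (t 1) with h01 | h01 <;> rcases le_total (t 1) (t 2) with h12 | h12 <;>
        rcases le_total (t 0) (t 2) with h02 | h02
      · have := key _ _ _ h01 h12 t0 h3 (by linarith); omega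
      · have := key _ _ _ h01 h12 t0 h3 (by linarith); omega
      · have := key _ _ _ h02 h12 t0 h1 (by linarith); omega
      · have := key _ _ _ h02 h01 t2 h1 (by linarith); omega
      · have := key _ _ _ h01 h02 t1 h3 (by linarith); omega
      · have := key _ _ _ h12 h02 t1 h0 (by linarith); omega
      · have := key _ _ _ h12 h01 t2 h0 (by linarith); omega
      · have := key _ _ _ h12 h01 t2 h0 (by linarith); omega
    have := hall j
    tauto

/-- An orbit sum with one orbit of `1 + p * j` points whose stabilizers have order `p * d` and an
orbit contributing the remaining summands leaves only `j = 1`. -/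
theorem eq_one_of_orbit_sum {n p d j : ℕ} (hp : 5 ≤ p) (hd : 1 ≤ d) (hdp : d ≤ p - 1) (hj : 1 ≤ j)
    {t : Fin n → ℕ} (i₀ : Fin n) (ht : ∀ i ≠ i₀, 2 ≤ t i) (ht₀ : t i₀ = p * d)
    (h : ∑ i, (1 - 1 / (t i : ℚ)) + (p - 1) / (p * d : ℚ) = 2 - 2 / ((1 + p * j) * (p * d) : ℚ)) :
    j = 1 := by
  have hp' : (5 : ℚ) ≤ p := by exact_mod_cast hp
  have hd' : (1 : ℚ) ≤ d := by exact_mod_cast hd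
  have hj' : (1 : ℚ) ≤ j := by exact_mod_cast hj
  rw [← Finset.add_sum_erase _ _ (Finset.mem_univ i₀), ht₀] at h
  push_cast at h
  have hpd : (0 : ℚ) < p * d := by positivity
  have hpj : (0 : ℚ) < 1 + p * j := by positivity
  have hS : ∑ i ∈ Finset.univ.erase i₀, (1 - 1 / (t i : ℚ)) =
      1 - (p - 2) / (p * d : ℚ) - 2 / ((1 + p * j) * (p * d) : ℚ) := by
    have : (p - 2 : ℚ) / (p * d) = (p - 1) / (p * d : ℚ) - 1 / (p * d : ℚ) := by ring
    rw [this]; linarith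
  have hpos : 0 < (p - 2 : ℚ) / (p * d) := div_pos (by linarith) hpd
  have hpos' : 0 < 2 / ((1 + p * j) * (p * d) : ℚ) := by positivity
  have hi : ∀ i ∈ Finset.univ.erase i₀, (1 : ℚ) / 2 ≤ 1 - 1 / (t i : ℚ) := by
    intro i hi
    have : (2 : ℚ) ≤ t i := by exact_mod_cast ht i (Finset.ne_of_mem_erase hi)
    have : (1 : ℚ) / t i ≤ 1 / 2 := one_div_le_one_div_of_le (by norm_num) this
    linarith
  have hc : (Finset.univ.erase i₀).card ≤ 1 := by
    by_contra hh
    have := Finset.card_nsmul_le_sum _ _ _ hi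
    rw [hS, nsmul_eq_mul] at this
    have h2 : (2 : ℚ) ≤ (Finset.univ.erase i₀).card := by exact_mod_cast not_le.1 hh
    linarith
  rcases Nat.le_one_iff_eq_zero_or_eq_one.1 hc with h0 | h1
  · rw [Finset.card_eq_zero.1 h0, Finset.sum_empty] at hS
    field_simp at hS
    exfalso
    have e : (p * d * (1 + p * j) : ℚ) = (p - 2) * (1 + p * j) + 2 := by linarith
    have e' : ((p * d * (1 + p * j) + 2 * (1 + p * j) : ℕ) : ℚ) = ((p * (1 + p * j) + 2 : ℕ) : ℚ) := by
      push_cast; linarith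
    have e'' := Nat.cast_injective e'
    have : p * 1 * (1 + p * j) ≤ p * d * (1 + p * j) := by gcongr
    nlinarith
  · obtain ⟨i, hi'⟩ := Finset.card_eq_one.1 h1
    rw [hi', Finset.sum_singleton] at hS
    have hii : i ≠ i₀ := Finset.ne_of_mem_erase (hi' ▸ Finset.mem_singleton_self i)
    have h2 := ht i hii
    generalize t i = m at hS h2
    have hm : (2 : ℚ) ≤ m := by exact_mod_cast h2
    have hS' : 1 / (m : ℚ) = (p - 2) / (p * d : ℚ) + 2 / ((1 + p * j) * (p * d) : ℚ) := by linarith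
    field_simp at hS'
    obtain ⟨q, rfl⟩ : ∃ q, p = q + 2 := ⟨p - 2, by omega⟩
    push_cast at hS'
    have e : (d * (1 + (q + 2) * j) : ℚ) = m * (1 + q * j) := by
      have : ((q : ℚ) + 2) ≠ 0 := by positivity
      apply mul_left_cancel₀ this
      linarith
    have e' : d * (1 + (q + 2) * j) = m * (1 + q * j) := by exact_mod_cast e
    have hdm : d ≤ m := by
      by_contra hh
      have : m * (1 + q * j) ≤ d * (1 + q * j) := by gcongr; omega
      nlinarith [Nat.mul_pos hd hj]
    obtain ⟨k, rfl⟩ := Nat.exists_eq_add_of_le hdm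
    have e2 : 2 * (d * j) = k * (1 + q * j) := by linarith
    have hk0 : k ≠ 0 := by rintro rfl; nlinarith [Nat.mul_pos hd hj]
    have hdj : d * j ≤ (q + 1) * j := by gcongr; omega
    have hk : k ≤ 2 := by
      by_contra hh
      have : 3 * (1 + q * j) ≤ k * (1 + q * j) := by gcongr; omega
      have : 3 * j ≤ q * j := by gcongr; omega
      linarith
    have hdvd : j ∣ 1 := by
      have : k = 1 ∨ k = 2 := by omega
      rcases this with rfl | rfl
      · have : j ∣ 1 + q * j := ⟨2 * d, by linarith⟩
        simpa using (Nat.dvd_add_left (Dvd.intro_left q rfl)).1 this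
      · have : j ∣ 1 + q * j := ⟨d, by linarith⟩
        simpa using (Nat.dvd_add_left (Dvd.intro_left q rfl)).1 this
    exact Nat.dvd_one.1 hdvd

section Moebius
variable {K : Type*} [Field K]

/-- The matrix in `SL(2, K)` of the translation by `b`. -/
def upperShear (b : K) : SL(2, K) := ⟨!![1, b; 0, 1], by simp⟩

theorem sl_det (g : SL(2, K)) : g 0 0 * g 1 1 - g 0 1 * g 1 0 = 1 := by
  have := g.det_coe
  rwa [Matrix.det_fin_two] at this

theorem sl_ext {g h : SL(2, K)} (h₁ : g 0 0 = h 0 0) (h₂ : g 0 1 = h 0 1) (h₃ : g 1 0 = h 1 0)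
    (h₄ : g 1 1 = h 1 1) : g = h := by
  ext i j
  fin_cases i <;> fin_cases j <;> assumption

theorem sl_mul_apply (g h : SL(2, K)) (i j : Fin 2) :
    (g * h) i j = g i 0 * h 0 j + g i 1 * h 1 j := by
  simp [Matrix.mul_apply, Fin.sum_univ_two]

theorem sl_inv_apply (g : SL(2, K)) :
    g⁻¹ 0 0 = g 1 1 ∧ g⁻¹ 0 1 = -g 0 1 ∧ g⁻¹ 1 0 = -g 1 0 ∧ g⁻¹ 1 1 = g 0 0 := by
  simp [Matrix.SpecialLinearGroup.SL2_inv_expl]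

theorem sl_eq_one_or_neg_one_iff {g : SL(2, K)} :
    (g = 1 ∨ g = -1) ↔ g 0 1 = 0 ∧ g 1 0 = 0 ∧ g 0 0 = g 1 1 := by
  constructor
  · rintro (rfl | rfl) <;> simp
  · rintro ⟨hb, hc, had⟩
    have := sl_det g
    have h : (g 0 0 - 1) * (g 0 0 + 1) = 0 := by rw [hb, ← had] at this; linear_combination this
    rcases mul_eq_zero.1 h with h | h
    · left
      apply sl_ext <;> simp [hb, hc, ← had]
      linear_combination h
      linear_combination h
    · right
      apply sl_ext <;> simp [hb, hc, ← had]
      linear_combination h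
      linear_combination h

theorem sl_mem_center_iff {g : SL(2, K)} :
    g ∈ Subgroup.center SL(2, K) ↔ g = 1 ∨ g = -1 := by
  constructor
  · intro h
    rw [Matrix.SpecialLinearGroup.mem_center_iff] at h
    obtain ⟨r, -, hr⟩ := h
    rw [sl_eq_one_or_neg_one_iff]
    have h' : ∀ i j, g i j = Matrix.scalar (Fin 2) r i j := fun i j => by rw [hr]
    simp [h']
  · rintro (rfl | rfl)
    · exact one_mem _
    · rw [Subgroup.mem_center_iff]; intro g; simp

variable [DecidableEq K]

/-- The action of `SL(2, K)` on the projective line by Möbius transformations. -/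
noncomputable instance slOnePointAction : MulAction SL(2, K) (OnePoint K) :=
  MulAction.compHom _ Matrix.SpecialLinearGroup.toGL

theorem sl_smul_infty (g : SL(2, K)) :
    g • (OnePoint.infty : OnePoint K) = if g 1 0 = 0 then OnePoint.infty else
      ((g 0 0 / g 1 0 : K) : OnePoint K) :=
  OnePoint.smul_infty_eq_ite (Matrix.SpecialLinearGroup.toGL g)

theorem sl_smul_coe (g : SL(2, K)) (z : K) :
    g • (z : OnePoint K) = if g 1 0 * z + g 1 1 = 0 then OnePoint.infty else
      (((g 0 0 * z + g 0 1) / (g 1 0 * z + g 1 1) : K) : OnePoint K) :=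
  OnePoint.smul_some_eq_ite (g := Matrix.SpecialLinearGroup.toGL g)

theorem sl_smul_infty_eq_self {g : SL(2, K)} :
    g • (OnePoint.infty : OnePoint K) = OnePoint.infty ↔ g 1 0 = 0 := by
  rw [sl_smul_infty]; split_ifs with h <;> simp [h]

theorem sl_smul_coe_eq_self {g : SL(2, K)} {z : K} :
    g • (z : OnePoint K) = z ↔ g 1 0 * z ^ 2 + (g 1 1 - g 0 0) * z - g 0 1 = 0 := by
  rw [sl_smul_coe]
  have := sl_det g
  split_ifs with h
  · simp only [OnePoint.infty_ne_coe, false_iff]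
    intro h2
    have h3 : g 0 0 * z + g 0 1 = 0 := by linear_combination z * h - h2
    have : (1 : K) = 0 := by
      rw [← this]; linear_combination g 0 0 * h - g 1 0 * h3
    exact one_ne_zero this
  · rw [OnePoint.coe_eq_coe, div_eq_iff h]
    constructor <;> intro h2 <;> linear_combination -h2

theorem sl_neg_one_smul (x : OnePoint K) : (-1 : SL(2, K)) • x = x := by
  cases x with
  | infty => rw [sl_smul_infty_eq_self]; simp
  | coe z => rw [sl_smul_coe_eq_self]; simp

theorem sl_fixedBy_ncard_of_parabolic (h2 : (2 : K) ≠ 0) {g : SL(2, K)} (hg : ¬ (g = 1 ∨ g = -1))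
    (ht : (g 0 0 + g 1 1) ^ 2 = 4) : (MulAction.fixedBy (OnePoint K) g).ncard = 1 := by
  rw [sl_eq_one_or_neg_one_iff] at hg
  have hdet := sl_det g
  rw [Set.ncard_eq_one]
  by_cases hc : g 1 0 = 0
  · have had : g 0 0 = g 1 1 := by
      have : (g 0 0 - g 1 1) ^ 2 = 0 := by
        rw [hc] at hdet; linear_combination ht - 4 * hdet
      exact sub_eq_zero.1 (pow_eq_zero_iff (two_ne_zero) |>.1 this)
    refine ⟨OnePoint.infty, ?_⟩
    ext x
    rw [MulAction.mem_fixedBy]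
    cases x with
    | infty => simp [sl_smul_infty_eq_self, hc]
    | coe z =>
      simp only [sl_smul_coe_eq_self, Set.mem_singleton_iff, OnePoint.coe_ne_infty, iff_false]
      rw [hc, had]
      intro h
      exact hg ⟨by linear_combination -h, hc, had⟩
  · refine ⟨(((g 0 0 - g 1 1) / (2 * g 1 0) : K) : OnePoint K), ?_⟩
    ext x
    rw [MulAction.mem_fixedBy]
    cases x with
    | infty => simp [sl_smul_infty_eq_self, hc]
    | coe z =>
      rw [sl_smul_coe_eq_self, Set.mem_singleton_iff, OnePoint.coe_eq_coe,
        eq_div_iff (mul_ne_zero h2 hc)]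
      have key : (2 * g 1 0 * z - (g 0 0 - g 1 1)) ^ 2 =
          4 * g 1 0 * (g 1 0 * z ^ 2 + (g 1 1 - g 0 0) * z - g 0 1) := by
        linear_combination ht - 4 * hdet
      constructor
      · intro h
        rw [h, mul_zero] at key
        have := pow_eq_zero_iff (two_ne_zero) |>.1 key
        linear_combination this
      · intro h
        have h0 : 2 * g 1 0 * z - (g 0 0 - g 1 1) = 0 := by linear_combination h
        rw [h0] at key
        have h4 : (4 * g 1 0 : K) ≠ 0 := by
          have : (4 : K) = 2 * 2 := by norm_num
          rw [this]; exact mul_ne_zero (mul_ne_zero h2 h2) hc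
        have := key.symm
        rw [zero_pow two_ne_zero] at this
        exact (mul_eq_zero.1 this).resolve_left h4

theorem sl_fixedBy_ncard [IsAlgClosed K] (h2 : (2 : K) ≠ 0) {g : SL(2, K)}
    (ht : (g 0 0 + g 1 1) ^ 2 ≠ 4) : (MulAction.fixedBy (OnePoint K) g).ncard = 2 := by
  have hdet := sl_det g
  rw [Set.ncard_eq_two]
  by_cases hc : g 1 0 = 0
  · have had : g 1 1 - g 0 0 ≠ 0 := by
      intro h
      apply ht
      rw [hc] at hdet; linear_combination 4 * hdet + (g 1 1 - g 0 0) * h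
    refine ⟨OnePoint.infty, ((g 0 1 / (g 1 1 - g 0 0) : K) : OnePoint K), by simp, ?_⟩
    ext x
    rw [MulAction.mem_fixedBy]
    cases x with
    | infty => simp [sl_smul_infty_eq_self, hc]
    | coe z =>
      simp only [sl_smul_coe_eq_self, Set.mem_insert_iff, Set.mem_singleton_iff,
        OnePoint.coe_ne_infty, false_or, OnePoint.coe_eq_coe]
      rw [hc, eq_div_iff had]
      constructor <;> intro h <;> linear_combination h
  · obtain ⟨r, hr⟩ := IsAlgClosed.exists_pow_nat_eq ((g 0 0 + g 1 1) ^ 2 - 4) two_pos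
    have hr0 : r ≠ 0 := by
      rintro rfl
      apply ht; linear_combination -hr
    have h2c := mul_ne_zero h2 hc
    refine ⟨(((g 0 0 - g 1 1 + r) / (2 * g 1 0) : K) : OnePoint K),
      (((g 0 0 - g 1 1 - r) / (2 * g 1 0) : K) : OnePoint K), ?_, ?_⟩
    · rw [Ne, OnePoint.coe_eq_coe, div_left_inj' h2c]
      intro h
      have : 2 * r = 0 := by linear_combination h
      exact mul_ne_zero h2 hr0 this
    · ext x
      rw [MulAction.mem_fixedBy]
      cases x with
      | infty => simp [sl_smul_infty_eq_self, hc]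
      | coe z =>
        rw [sl_smul_coe_eq_self, Set.mem_insert_iff, Set.mem_singleton_iff, OnePoint.coe_eq_coe,
          OnePoint.coe_eq_coe, eq_div_iff h2c, eq_div_iff h2c]
        have key : (z * (2 * g 1 0) - (g 0 0 - g 1 1 + r)) * (z * (2 * g 1 0) - (g 0 0 - g 1 1 - r))
            = 4 * g 1 0 * (g 1 0 * z ^ 2 + (g 1 1 - g 0 0) * z - g 0 1) := by
          linear_combination - hr - 4 * hdet
        have h4 : (4 * g 1 0 : K) ≠ 0 := by
          have : (4 : K) = 2 * 2 := by norm_num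
          rw [this]; exact mul_ne_zero (mul_ne_zero h2 h2) hc
        rw [← sub_eq_zero (b := g 0 0 - g 1 1 + r), ← sub_eq_zero (b := g 0 0 - g 1 1 - r),
          ← mul_eq_zero, key, mul_eq_zero]
        tauto

end Moebius

section Klein
variable {K : Type*} [Field K] [DecidableEq K]

/-- The parabolic elements of a subgroup of `SL(2, K)`. -/
def parabolics {K : Type*} [Field K] (H : Subgroup SL(2, K)) : Set H :=
  {g | ¬ ((g : SL(2, K)) = 1 ∨ (g : SL(2, K)) = -1) ∧ ((g : SL(2, K)) 0 0 + (g : SL(2, K)) 1 1) ^ 2 = 4}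

theorem mem_center_subgroupOf {K : Type*} [Field K] {H : Subgroup SL(2, K)} {g : H} :
    g ∈ (Subgroup.center SL(2, K)).subgroupOf H ↔ ((g : SL(2, K)) = 1 ∨ (g : SL(2, K)) = -1) := by
  rw [Subgroup.mem_subgroupOf, sl_mem_center_iff]

theorem sl_neg_one_ne_one {K : Type*} [Field K] (h2 : (2 : K) ≠ 0) : (-1 : SL(2, K)) ≠ 1 := by
  intro h
  have : (-1 : SL(2, K)) 0 0 = (1 : SL(2, K)) 0 0 := by rw [h]
  simp at this
  apply h2
  linear_combination -this

theorem card_center_subgroupOf {K : Type*} [Field K] (h2 : (2 : K) ≠ 0) {H : Subgroup SL(2, K)}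
    (hH : -1 ∈ H) : Nat.card ((Subgroup.center SL(2, K)).subgroupOf H) = 2 := by
  have : (((Subgroup.center SL(2, K)).subgroupOf H : Subgroup H) : Set H) =
      {1, ⟨-1, hH⟩} := by
    ext g
    rw [SetLike.mem_coe, mem_center_subgroupOf]
    simp only [Set.mem_insert_iff, Set.mem_singleton_iff, Subtype.ext_iff, OneMemClass.coe_one]
  rw [← SetLike.coe_sort_coe, Nat.card_coe_set_eq, this, Set.ncard_pair]
  intro h
  exact sl_neg_one_ne_one h2 (congrArg Subtype.val h).symm

theorem exists_two_mul_card_stabilizer (h2 : (2 : K) ≠ 0) {H : Subgroup SL(2, K)} [Finite H]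
    (hH : -1 ∈ H) {x : OnePoint K} (hx : ∃ g : H, ¬ ((g : SL(2, K)) = 1 ∨ (g : SL(2, K)) = -1) ∧ g • x = x) :
    ∃ t, 2 ≤ t ∧ Nat.card (MulAction.stabilizer H x) = 2 * t := by
  have hle : (Subgroup.center SL(2, K)).subgroupOf H ≤ MulAction.stabilizer H x := by
    intro g hg
    rw [MulAction.mem_stabilizer_iff]
    rcases mem_center_subgroupOf.1 hg with h | h
    · rw [Subgroup.smul_def, h, one_smul]
    · rw [Subgroup.smul_def, h, sl_neg_one_smul]
  have hdvd := Subgroup.card_dvd_of_le hle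
  rw [card_center_subgroupOf h2 hH] at hdvd
  obtain ⟨t, ht⟩ := hdvd
  refine ⟨t, ?_, ht⟩
  have hpos : 0 < Nat.card (MulAction.stabilizer H x) := Nat.card_pos
  by_contra hlt
  have ht1 : t = 1 := by omega
  obtain ⟨g, hg, hgx⟩ := hx
  have := Subgroup.eq_of_le_of_card_ge hle (by rw [ht, ht1, card_center_subgroupOf h2 hH])
  have hg' : g ∈ MulAction.stabilizer H x := hgx
  rw [← this] at hg'
  exact hg (mem_center_subgroupOf.1 hg')

/-- The orbit count for a finite subgroup of `SL(2, K)` acting on the projective line. -/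
theorem exists_klein_orbits [IsAlgClosed K] (h2 : (2 : K) ≠ 0) {H : Subgroup SL(2, K)} [Finite H]
    (hH : -1 ∈ H) : ∃ (n : ℕ) (x : Fin n → OnePoint K) (t : Fin n → ℕ) (g : ℕ),
      Nat.card H = 2 * g ∧ (∀ i, 2 ≤ t i) ∧
      (∀ i, Nat.card (MulAction.stabilizer H (x i)) = 2 * t i) ∧
      (∀ y, (∃ g : H, ¬ ((g : SL(2, K)) = 1 ∨ (g : SL(2, K)) = -1) ∧ g • y = y) →
        ∃ i, y ∈ MulAction.orbit H (x i)) ∧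
      (∀ i j, x i ∈ MulAction.orbit H (x j) → i = j) ∧
      ∑ i, (1 - 1 / (t i : ℚ)) + (parabolics H).ncard / (2 * g : ℚ) = 2 - 2 / (g : ℚ) := by
  obtain ⟨n, x, hx, hy, hij, hsum⟩ := exists_orbit_representatives (G := H) (X := OnePoint K)
    ((Subgroup.center SL(2, K)).subgroupOf H) (parabolics H) (by
      intro z hz x
      rcases mem_center_subgroupOf.1 hz with h | h
      · rw [Subgroup.smul_def, h, one_smul]
      · rw [Subgroup.smul_def, h, sl_neg_one_smul])
    (card_center_subgroupOf h2 hH) (fun g hg => fun h => hg.1 (mem_center_subgroupOf.1 h))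
    (fun g hg => sl_fixedBy_ncard_of_parabolic h2 hg.1 hg.2)
    (fun g hg hg' => sl_fixedBy_ncard h2 fun h => hg' ⟨fun h' => hg (mem_center_subgroupOf.2 h'), h⟩)
  simp only [mem_center_subgroupOf] at hx hy
  choose t ht hst using fun i => exists_two_mul_card_stabilizer h2 hH (hx i)
  have hg := Subgroup.card_subgroup_dvd_card ((Subgroup.center SL(2, K)).subgroupOf H)
  rw [card_center_subgroupOf h2 hH] at hg
  obtain ⟨g, hg⟩ := hg
  refine ⟨n, x, t, g, hg, ht, hst, hy, hij, ?_⟩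
  rw [hg] at hsum
  simp_rw [hst] at hsum
  push_cast at hsum
  have e1 : ∀ a : ℚ, 2 / (2 * a) = 1 / a := fun a => by
    rw [show (2 : ℚ) / (2 * a) = (2 * 1) / (2 * a) by norm_num, mul_div_mul_left _ _ two_ne_zero]
  have e2 : (4 : ℚ) / (2 * g) = 2 / g := by
    rw [show (4 : ℚ) / (2 * g) = (2 * 2) / (2 * g) by norm_num, mul_div_mul_left _ _ two_ne_zero]
  simp_rw [e1, e2] at hsum
  exact hsum

/-- A finite subgroup of `SL(2, K)` without parabolic elements and of order divisible by `60` either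
has a subgroup of index two fixing a point, or is binary icosahedral. -/
theorem icosahedral_of_no_parabolic [IsAlgClosed K] (h2 : (2 : K) ≠ 0) {H : Subgroup SL(2, K)} [Finite H]
    (hH : -1 ∈ H) (hp : ∀ g ∈ H, (g 0 0 + g 1 1) ^ 2 = 4 → g = 1 ∨ g = -1)
    (h60 : 60 ∣ Nat.card H) :
    (∃ x : OnePoint K, ∀ g ∈ H, (g ^ 2) • x = x) ∨ ∀ g ∈ H, g ^ 4 = 1 ∨ g ^ 6 = 1 ∨ g ^ 10 = 1 := by
  obtain ⟨n, x, t, g, hg, ht, hst, hy, -, hsum⟩ := exists_klein_orbits h2 hH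
  have hP : parabolics H = ∅ := by
    ext h
    simp only [parabolics, Set.mem_ofPred_eq, Set.mem_empty_iff_false, iff_false]
    exact fun hh => hh.1 (hp _ h.2 hh.2)
  rw [hP, Set.ncard_empty, Nat.cast_zero, zero_div, add_zero] at hsum
  have hgpos : 0 < Nat.card H := Nat.card_pos
  have h30 : 30 ≤ g := by
    have := Nat.le_of_dvd hgpos h60; omega
  have htg : ∀ i, t i ≤ g := by
    intro i
    have := Nat.le_of_dvd hgpos (Subgroup.card_subgroup_dvd_card (MulAction.stabilizer H (x i)))
    rw [hg, hst] at this
    omega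
  rcases signature_of_orbit_sum ht htg h30 hsum with ⟨i, hi⟩ | hall
  · left
    refine ⟨x i, fun h hh => ?_⟩
    have hind := Subgroup.card_mul_index (MulAction.stabilizer H (x i))
    rw [hg, hst] at hind
    have hle : (MulAction.stabilizer H (x i)).index ≤ 2 := by
      by_contra hcon
      have : 2 * t i * 3 ≤ 2 * t i * (MulAction.stabilizer H (x i)).index := by
        gcongr; omega
      have := ht i
      omega
    have hne : (MulAction.stabilizer H (x i)).index ≠ 0 := Subgroup.FiniteIndex.index_ne_zero
    have hmem : (⟨h, hh⟩ : H) ^ 2 ∈ MulAction.stabilizer H (x i) := by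
      rcases (by omega : (MulAction.stabilizer H (x i)).index = 1 ∨
          (MulAction.stabilizer H (x i)).index = 2) with h1 | h1
      · rw [Subgroup.index_eq_one.1 h1]; trivial
      · exact Subgroup.sq_mem_of_index_two h1 _
    exact hmem
  · right
    intro h hh
    by_cases hc : h = 1 ∨ h = -1
    · left
      rcases hc with rfl | rfl
      · simp
      · exact Even.neg_one_pow (by decide)
    · have h4 : (h 0 0 + h 1 1) ^ 2 ≠ 4 := fun h4 => hc (hp h hh h4)
      have hne : (MulAction.fixedBy (OnePoint K) h).Nonempty := by
        apply Set.nonempty_of_ncard_ne_zero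
        rw [sl_fixedBy_ncard h2 h4]; norm_num
      obtain ⟨y, hy'⟩ := hne
      obtain ⟨i, hi⟩ := hy y ⟨⟨h, hh⟩, hc, hy'⟩
      obtain ⟨k, hk⟩ := hi
      have hs : k⁻¹ * ⟨h, hh⟩ * k ∈ MulAction.stabilizer H (x i) := by
        rw [MulAction.mem_stabilizer_iff, mul_smul, mul_smul, inv_smul_eq_iff]
        change _ • (fun m : H => m • x i) k = (fun m : H => m • x i) k
        rw [hk]
        exact hy'
      have hpow := congrArg Subtype.val (pow_card_eq_one' (x := (⟨_, hs⟩ : MulAction.stabilizer H (x i))))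
      have hpow' := congrArg Subtype.val hpow
      have hconj := conj_pow (a := (k : SL(2, K))⁻¹) (b := h) (i := 2 * t i)
      rw [inv_inv] at hconj
      simp only [hst, SubgroupClass.coe_pow, Subgroup.coe_mul, InvMemClass.coe_inv,
        OneMemClass.coe_one] at hpow'
      rw [hconj] at hpow'
      have : h ^ (2 * t i) = 1 := by
        calc h ^ (2 * t i) = k * ((k : SL(2, K))⁻¹ * h ^ (2 * t i) * k) * (k : SL(2, K))⁻¹ := by group
          _ = 1 := by rw [hpow']; group
      rcases hall i with h' | h' | h' <;> rw [h'] at this <;> simp [this]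
end Klein

section Parabolic
variable {K : Type*} [Field K]

theorem upperShear_add (a b : K) : upperShear (a + b) = upperShear a * upperShear b := by
  apply sl_ext <;> simp only [sl_mul_apply] <;> simp [upperShear, add_comm]

theorem upperShear_zero : upperShear (0 : K) = 1 := by
  apply sl_ext <;> simp [upperShear]

theorem upperShear_injective : Function.Injective (upperShear : K → SL(2, K)) := by
  intro a b h
  have : upperShear a 0 1 = upperShear b 0 1 := by rw [h]
  simpa [upperShear] using this

/-- The translations contained in a subgroup of `SL(2, K)`. -/
def shears (H : Subgroup SL(2, K)) : AddSubgroup K where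
  carrier := {b | upperShear b ∈ H}
  zero_mem' := by simp [upperShear_zero, H.one_mem]
  add_mem' := by
    intro a b ha hb
    simp only [Set.mem_ofPred_eq, upperShear_add] at *
    exact H.mul_mem ha hb
  neg_mem' := by
    intro a ha
    simp only [Set.mem_ofPred_eq] at *
    have : upperShear (-a) = (upperShear a)⁻¹ := by
      rw [eq_inv_iff_mul_eq_one, ← upperShear_add, neg_add_cancel, upperShear_zero]
    rw [this]; exact H.inv_mem ha

theorem mem_shears {H : Subgroup SL(2, K)} {b : K} : b ∈ shears H ↔ upperShear b ∈ H := Iff.rfl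

/-- Conjugating translations by upper triangular matrices. -/
theorem sq_mul_mem_shears {H : Subgroup SL(2, K)} {g : SL(2, K)} (hg : g ∈ H) (hc : g 1 0 = 0)
    {b : K} (hb : b ∈ shears H) : g 0 0 ^ 2 * b ∈ shears H := by
  rw [mem_shears] at *
  have hdet := sl_det g
  have : upperShear (g 0 0 ^ 2 * b) = g * upperShear b * g⁻¹ := by
    obtain ⟨i1, i2, i3, i4⟩ := sl_inv_apply g
    apply sl_ext <;> simp only [sl_mul_apply, i1, i2, i3, i4] <;> simp [upperShear, hc] <;>
      rw [hc] at hdet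
    · linear_combination -hdet
    · ring
    · linear_combination -hdet
  rw [this]
  exact H.mul_mem (H.mul_mem hg hb) (H.inv_mem hg)

variable {p : ℕ} [Fact p.Prime] [CharP K p]

theorem div_pow_eq_of_mem_shears {H : Subgroup SL(2, K)} (hV : Nat.card (shears H) = p) {v w : K}
    (hv : v ∈ shears H) (hw : w ∈ shears H) : (v / w) ^ p = v / w := by
  by_cases h0 : w = 0
  · simp [h0, (Fact.out : p.Prime).ne_zero]
  · have := mem_zmultiples_of_prime_card (G := shears H) hV (g := ⟨w, hw⟩) (g' := ⟨v, hv⟩)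
      (by simpa [Subtype.ext_iff] using h0)
    obtain ⟨n, hn⟩ := AddSubgroup.mem_zmultiples_iff.1 this
    have hn' : n • w = v := congrArg Subtype.val hn
    rw [← hn', zsmul_eq_mul, mul_div_cancel_right₀ _ h0]
    have := map_intCast (frobenius K p) n
    rwa [frobenius_def] at this

theorem sl_pow_char_eq_one {g : SL(2, K)} (ht : g 0 0 + g 1 1 = 2) : g ^ p = 1 := by
  have hdet := sl_det g
  have h2 : ((g : Matrix (Fin 2) (Fin 2) K) - 1) ^ 2 = 0 := by
    have hd : g 1 1 = 2 - g 0 0 := by linear_combination ht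
    rw [pow_two]
    ext i j
    fin_cases i <;> fin_cases j <;>
      simp [Matrix.mul_apply, Fin.sum_univ_two, hd] <;> rw [hd] at hdet
    · linear_combination -hdet
    · ring
    · ring
    · linear_combination -hdet
  have hp : ((g : Matrix (Fin 2) (Fin 2) K) - 1) ^ p = 0 :=
    pow_eq_zero_of_le (Fact.out : p.Prime).two_le h2
  rw [sub_pow_char_of_commute p (h := Commute.one_right _), one_pow, sub_eq_zero] at hp
  apply Subtype.ext
  simpa using hp

/-- A finite group of upper triangular matrices containing exactly `p` translations. -/
theorem exists_card_stabilizer_infty [DecidableEq K] (h2 : (2 : K) ≠ 0) {H : Subgroup SL(2, K)}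
    [Finite H] (hH : -1 ∈ H) (hV : Nat.card (shears H) = p) :
    ∃ d, 1 ≤ d ∧ d ≤ p - 1 ∧
      Nat.card (MulAction.stabilizer H (OnePoint.infty : OnePoint K)) = 2 * (p * d) := by
  set S := MulAction.stabilizer H (OnePoint.infty : OnePoint K)
  have hS : ∀ g : S, (g : SL(2, K)) 1 0 = 0 := fun g => sl_smul_infty_eq_self.1 g.2
  let f : S →* K :=
    { toFun := fun g => (g : SL(2, K)) 0 0
      map_one' := by simp
      map_mul' := fun g h => by
        simp only [Subgroup.coe_mul, sl_mul_apply, hS h, mul_zero, add_zero] }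
  let χ := f.toHomUnits
  have hχ : ∀ g, (χ g : K) = (g : SL(2, K)) 0 0 := fun g => rfl
  have hker : Nat.card χ.ker = p := by
    rw [← hV]
    refine Nat.card_congr (Equiv.ofBijective (fun g => ⟨(g : SL(2, K)) 0 1, ?_⟩) ⟨?_, ?_⟩)
    · have h00 : (g : SL(2, K)) 0 0 = 1 := by
        rw [← hχ, MonoidHom.mem_ker.1 g.2]; rfl
      have h10 := hS g
      have h11 : (g : SL(2, K)) 1 1 = 1 := by
        have := sl_det (g : SL(2, K)); rw [h00, h10] at this; linear_combination this
      rw [mem_shears]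
      have : upperShear ((g : SL(2, K)) 0 1) = (g : SL(2, K)) := by
        apply sl_ext <;> simp [upperShear, h00, h10, h11]
      rw [this]
      exact g.1.1.2
    · intro g h hgh
      have h01 : (g : SL(2, K)) 0 1 = (h : SL(2, K)) 0 1 := congrArg Subtype.val hgh
      have key : ∀ g : χ.ker, (g : SL(2, K)) 0 0 = 1 ∧ (g : SL(2, K)) 1 0 = 0 ∧
          (g : SL(2, K)) 1 1 = 1 := fun g => by
        have h00 : (g : SL(2, K)) 0 0 = 1 := by
          rw [← hχ, MonoidHom.mem_ker.1 g.2]; rfl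
        have h10 := hS g
        refine ⟨h00, h10, ?_⟩
        have := sl_det (g : SL(2, K)); rw [h00, h10] at this; linear_combination this
      obtain ⟨a1, a2, a3⟩ := key g
      obtain ⟨b1, b2, b3⟩ := key h
      exact Subtype.ext (Subtype.ext (Subtype.ext (sl_ext (a1.trans b1.symm) h01
        (a2.trans b2.symm) (a3.trans b3.symm))))
    · rintro ⟨b, hb⟩
      have hbS : (⟨upperShear b, hb⟩ : H) ∈ S := by
        refine sl_smul_infty_eq_self.2 ?_
        simp [upperShear]
      refine ⟨⟨⟨⟨upperShear b, hb⟩, hbS⟩, ?_⟩, ?_⟩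
      · rw [MonoidHom.mem_ker]
        apply Units.ext
        rw [hχ]
        simp [upperShear]
      · apply Subtype.ext
        simp [upperShear]
  have : Finite χ.range := Finite.of_surjective χ.rangeRestrict χ.rangeRestrict_surjective
  have hrange : 2 ∣ Nat.card χ.range := by
    have hmem : (-1 : Kˣ) ∈ χ.range := by
      refine ⟨⟨⟨-1, hH⟩, sl_neg_one_smul _⟩, ?_⟩
      apply Units.ext
      rw [hχ]
      simp
    have h1 : orderOf (-1 : Kˣ) = 2 := by
      refine orderOf_eq_prime (by simp) fun h => h2 ?_
      have := congrArg Units.val h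
      simp only [Units.val_neg, Units.val_one] at this
      linear_combination -this
    have := Subgroup.orderOf_dvd_natCard _ hmem
    rwa [h1] at this
  have hp2 : 2 ≤ p := (Fact.out : p.Prime).two_le
  have hle : Nat.card χ.range ≤ 2 * (p - 1) := by
    have : NeZero (2 * (p - 1)) := ⟨by omega⟩
    obtain ⟨⟨w, hw⟩, hw0⟩ : ∃ w : shears H, w ≠ 0 := by
      have : Finite (shears H) := Nat.finite_of_card_ne_zero (by omega)
      have : Nontrivial (shears H) := Finite.one_lt_card_iff_nontrivial.1 (by omega)
      exact exists_ne 0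
    have hw0 : w ≠ 0 := fun h => hw0 (Subtype.ext h)
    have hsub : χ.range ≤ rootsOfUnity (2 * (p - 1)) K := by
      rintro _ ⟨g, rfl⟩
      rw [mem_rootsOfUnity']
      have h := div_pow_eq_of_mem_shears hV (sq_mul_mem_shears g.1.2 (hS g) hw) hw
      rw [← hχ, mul_div_cancel_right₀ _ hw0] at h
      have hne : ((χ g : K)) ^ 2 ≠ 0 := pow_ne_zero _ (Units.ne_zero _)
      rw [pow_mul]
      apply mul_right_cancel₀ hne
      rw [← pow_succ, one_mul, Nat.sub_add_cancel (by omega), h]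
    calc Nat.card χ.range ≤ Nat.card (rootsOfUnity (2 * (p - 1)) K) := Subgroup.card_le_of_le hsub
      _ ≤ 2 * (p - 1) := card_rootsOfUnity K _
  obtain ⟨d, hd⟩ := hrange
  have hpos : 0 < Nat.card χ.range := Nat.card_pos
  refine ⟨d, by omega, by omega, ?_⟩
  have := Subgroup.card_mul_index χ.ker
  rw [Subgroup.index_ker, hker, hd] at this
  rw [← this]; ring

theorem card_orbit_modEq [DecidableEq K] {H : Subgroup SL(2, K)} [Finite H] {u : SL(2, K)}
    (hu : u ∈ H) (ht : u 0 0 + u 1 1 = 2) (x : OnePoint K) :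
    Nat.card (MulAction.orbit H x) ≡
      {y : MulAction.orbit H x | u • (y : OnePoint K) = y}.ncard [MOD p] := by
  let Q := Subgroup.zpowers (⟨u, hu⟩ : H)
  have hup : (⟨u, hu⟩ : H) ^ p = 1 := Subtype.ext (sl_pow_char_eq_one ht)
  have hQ : IsPGroup p Q := by
    intro g
    refine ⟨1, ?_⟩
    rw [pow_one]
    obtain ⟨n, hn⟩ := g.2
    apply Subtype.ext
    simp only [SubmonoidClass.coe_pow, ← hn, OneMemClass.coe_one]
    rw [← zpow_natCast, ← zpow_mul, mul_comm, zpow_mul, zpow_natCast, hup, one_zpow]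
  have : Finite (MulAction.orbit H x) := Set.finite_range _
  have := hQ.card_modEq_card_fixedPoints (MulAction.orbit H x)
  rw [Nat.card_coe_set_eq (MulAction.fixedPoints Q _)] at this
  convert this using 2
  ext y
  rw [Set.mem_ofPred_eq, MulAction.mem_fixedPoints]
  constructor
  · intro h g
    have hst : (⟨u, hu⟩ : H) ∈ MulAction.stabilizer H y := Subtype.ext h
    have : Q ≤ MulAction.stabilizer H y := by
      rw [Subgroup.zpowers_le]; exact hst
    exact this g.2
  · intro h
    exact congrArg Subtype.val (h ⟨_, Subgroup.mem_zpowers _⟩)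
end Parabolic

section Parabolic
variable {K : Type*} [Field K] {p : ℕ} [Fact p.Prime] [DecidableEq K]

theorem ncard_parabolics_infty (h2 : (2 : K) ≠ 0) {H : Subgroup SL(2, K)} [Finite H]
    (hH : -1 ∈ H) (hV : Nat.card (shears H) = p) :
    {u : H | u ∈ parabolics H ∧ u • (OnePoint.infty : OnePoint K) = OnePoint.infty}.ncard =
      2 * (p - 1) := by
  have : Finite (shears H) := Nat.finite_of_card_ne_zero (by
    rw [hV]; exact (Fact.out : p.Prime).ne_zero)
  let f : shears H → H := fun b => ⟨upperShear (b : K), b.2⟩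
  have hf : Function.Injective f := fun a b h =>
    Subtype.ext (upperShear_injective (congrArg Subtype.val h))
  let m : H := ⟨-1, hH⟩
  have hm : Function.Injective fun b => m * f b := (mul_right_injective m).comp hf
  have hmf : ∀ b, ((m * f b : H) : SL(2, K)) 0 0 = -1 ∧ ((m * f b : H) : SL(2, K)) 0 1 = -b ∧
      ((m * f b : H) : SL(2, K)) 1 0 = 0 ∧ ((m * f b : H) : SL(2, K)) 1 1 = -1 := by
    intro b
    simp only [f, m, Subgroup.coe_mul, sl_mul_apply]
    simp [upperShear]
  have hc : ({0}ᶜ : Set (shears H)).ncard = p - 1 := by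
    rw [Set.ncard_compl, Set.ncard_singleton, hV]
  have hu : {u : H | u ∈ parabolics H ∧ u • (OnePoint.infty : OnePoint K) = OnePoint.infty} =
      f '' {0}ᶜ ∪ (fun b => m * f b) '' {0}ᶜ := by
    ext u
    simp only [Set.mem_ofPred_eq, Set.mem_union, Set.mem_image, Set.mem_compl_singleton_iff]
    constructor
    · rintro ⟨⟨hu, ht⟩, hfix⟩
      rw [sl_eq_one_or_neg_one_iff] at hu
      have h10 : (u : SL(2, K)) 1 0 = 0 := sl_smul_infty_eq_self.1 hfix
      have hdet := sl_det (u : SL(2, K))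
      have had : (u : SL(2, K)) 0 0 = (u : SL(2, K)) 1 1 := by
        have : ((u : SL(2, K)) 0 0 - (u : SL(2, K)) 1 1) ^ 2 = 0 := by
          rw [h10] at hdet; linear_combination ht - 4 * hdet
        exact sub_eq_zero.1 (pow_eq_zero_iff two_ne_zero |>.1 this)
      have h01 : (u : SL(2, K)) 0 1 ≠ 0 := fun h => hu ⟨h, h10, had⟩
      have h1 : ((u : SL(2, K)) 0 0 - 1) * ((u : SL(2, K)) 0 0 + 1) = 0 := by
        rw [h10, ← had] at hdet; linear_combination hdet
      rcases mul_eq_zero.1 h1 with h1 | h1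
      · left
        have h00 : (u : SL(2, K)) 0 0 = 1 := by linear_combination h1
        have : upperShear ((u : SL(2, K)) 0 1) = u := by
          apply sl_ext <;> simp [upperShear, h10, ← had, h00]
        refine ⟨⟨_, ?_⟩, ?_, Subtype.ext this⟩
        · rw [mem_shears, this]; exact u.2
        · exact fun h => h01 (congrArg Subtype.val h)
      · right
        have h00 : (u : SL(2, K)) 0 0 = -1 := by linear_combination h1
        have : upperShear (-(u : SL(2, K)) 0 1) = -1 * u := by
          apply sl_ext <;> simp [upperShear, h10, ← had, h00]
        refine ⟨⟨-(u : SL(2, K)) 0 1, ?_⟩, ?_, Subtype.ext ?_⟩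
        · rw [mem_shears, this]; exact H.mul_mem hH u.2
        · exact fun h => h01 (neg_eq_zero.1 (congrArg Subtype.val h))
        · change -1 * upperShear _ = _
          rw [this]; simp
    · have key : ∀ b : shears H, b ≠ 0 → (b : K) ≠ 0 := fun b h h' => h (Subtype.ext h')
      rintro (⟨b, hb, rfl⟩ | ⟨b, hb, rfl⟩)
      · refine ⟨⟨?_, ?_⟩, sl_smul_infty_eq_self.2 ?_⟩
        · rw [sl_eq_one_or_neg_one_iff]
          simp [f, upperShear, key b hb]
        · simp [f, upperShear]; norm_num
        · simp [f, upperShear]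
      · obtain ⟨h1, h2, h3, h4⟩ := hmf b
        refine ⟨⟨?_, ?_⟩, sl_smul_infty_eq_self.2 h3⟩
        · rw [sl_eq_one_or_neg_one_iff, h2]
          simp [key b hb]
        · rw [h1, h4]; norm_num
  rw [hu, Set.ncard_union_eq, Set.ncard_image_of_injective _ hf, Set.ncard_image_of_injective _ hm,
    hc, two_mul]
  rw [Set.disjoint_left]
  rintro _ ⟨a, -, rfl⟩ ⟨b, -, hb⟩
  have h := congrArg (fun u : H => (u : SL(2, K)) 0 0) hb
  simp only [(hmf b).1] at h
  simp [f, upperShear] at h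
  exact h2 (by linear_combination -h)

variable [CharP K p]

theorem exists_mem_shears_ne_zero {K : Type*} [Field K] {p : ℕ} [Fact p.Prime] {H : Subgroup SL(2, K)} (hV : Nat.card (shears H) = p) :
    ∃ b ∈ shears H, b ≠ 0 := by
  have hp2 : 2 ≤ p := (Fact.out : p.Prime).two_le
  have : Finite (shears H) := Nat.finite_of_card_ne_zero (by omega)
  have : Nontrivial (shears H) := Finite.one_lt_card_iff_nontrivial.1 (by omega)
  obtain ⟨⟨w, hw⟩, hw0⟩ := exists_ne (0 : shears H)
  exact ⟨w, hw, fun h => hw0 (Subtype.ext h)⟩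

theorem upperShear_smul_eq_self {b : K} (hb : b ≠ 0) {y : OnePoint K} :
    upperShear b • y = y ↔ y = OnePoint.infty := by
  cases y with
  | infty => rw [sl_smul_infty_eq_self]; simp [upperShear]
  | coe z => rw [sl_smul_coe_eq_self]; simp [upperShear, hb]

theorem card_orbit_infty_modEq {H : Subgroup SL(2, K)} [Finite H]
    (hV : Nat.card (shears H) = p) :
    Nat.card (MulAction.orbit H (OnePoint.infty : OnePoint K)) ≡ 1 [MOD p] := by
  obtain ⟨b, hb, hb0⟩ := exists_mem_shears_ne_zero hV
  have := card_orbit_modEq (p := p) (mem_shears.1 hb) (by simp [upperShear]; norm_num)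
    (OnePoint.infty : OnePoint K)
  refine this.trans ?_
  have hs : {y : MulAction.orbit H (OnePoint.infty : OnePoint K) |
      upperShear b • (y : OnePoint K) = y} = {⟨OnePoint.infty, MulAction.mem_orbit_self _⟩} := by
    ext y
    rw [Set.mem_ofPred_eq, upperShear_smul_eq_self hb0, Set.mem_singleton_iff, Subtype.ext_iff]
  rw [hs, Set.ncard_singleton]

theorem exists_mem_orbit_infty_of_mem_parabolics {H : Subgroup SL(2, K)} [Finite H]
    (hH : -1 ∈ H) (hV : Nat.card (shears H) = p) {u : H} (hu : u ∈ parabolics H) :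
    ∃ y ∈ MulAction.orbit H (OnePoint.infty : OnePoint K), u • y = y := by
  have key : ∀ w : H, (w : SL(2, K)) 0 0 + (w : SL(2, K)) 1 1 = 2 →
      ∃ y ∈ MulAction.orbit H (OnePoint.infty : OnePoint K), w • y = y := by
    intro w hw
    have h := (card_orbit_modEq (p := p) w.2 hw (OnePoint.infty : OnePoint K)).symm.trans
      (card_orbit_infty_modEq hV)
    by_contra! hcon
    have hs : {y : MulAction.orbit H (OnePoint.infty : OnePoint K) |
        (w : SL(2, K)) • (y : OnePoint K) = y} = ∅ := by
      rw [Set.eq_empty_iff_forall_notMem]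
      exact fun y hy => hcon y y.2 hy
    rw [hs, Set.ncard_empty] at h
    have := (Nat.modEq_zero_iff_dvd.1 h.symm)
    exact (Fact.out : p.Prime).one_lt.ne' (Nat.dvd_one.1 this)
  have h := hu.2
  have : ((u : SL(2, K)) 0 0 + (u : SL(2, K)) 1 1 - 2) *
      ((u : SL(2, K)) 0 0 + (u : SL(2, K)) 1 1 + 2) = 0 := by linear_combination h
  rcases mul_eq_zero.1 this with h | h
  · exact key u (by linear_combination h)
  · obtain ⟨y, hy, hyu⟩ := key (⟨-1, hH⟩ * u) (by simp; linear_combination -h)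
    refine ⟨y, hy, ?_⟩
    rw [mul_smul] at hyu
    exact (sl_neg_one_smul _).symm.trans hyu

theorem ncard_parabolics (h2 : (2 : K) ≠ 0) {H : Subgroup SL(2, K)} [Finite H]
    (hH : -1 ∈ H) (hV : Nat.card (shears H) = p) :
    (parabolics H).ncard =
      Nat.card (MulAction.orbit H (OnePoint.infty : OnePoint K)) * (2 * (p - 1)) := by
  have hfO : Finite (MulAction.orbit H (OnePoint.infty : OnePoint K)) := Set.finite_range _
  have := Fintype.ofFinite (MulAction.orbit H (OnePoint.infty : OnePoint K))
  choose y hy hyu using fun u : parabolics H => exists_mem_orbit_infty_of_mem_parabolics hH hV u.2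
  let φ : parabolics H → MulAction.orbit H (OnePoint.infty : OnePoint K) := fun u => ⟨y u, hy u⟩
  have huniq : ∀ u : parabolics H, ∀ z, u.1 • z = z → z = y u := by
    intro u z hz
    have h := sl_fixedBy_ncard_of_parabolic h2 u.2.1 u.2.2
    obtain ⟨w, hw⟩ := Set.ncard_eq_one.1 h
    have h1 : z ∈ ({w} : Set (OnePoint K)) := hw ▸ hz
    have h2 : y u ∈ ({w} : Set (OnePoint K)) := hw ▸ hyu u
    exact h1.trans h2.symm
  rw [← Nat.card_coe_set_eq, ← Nat.card_congr (Equiv.sigmaFiberEquiv φ), Nat.card_sigma]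
  rw [Finset.sum_congr rfl (g := fun _ => 2 * (p - 1)), Finset.sum_const, Finset.card_univ,
    Nat.card_eq_fintype_card, smul_eq_mul]
  rintro ⟨z, k, rfl⟩ -
  rw [← ncard_parabolics_infty h2 hH hV, ← Nat.card_coe_set_eq]
  have hconj : ∀ (k u : H), u ∈ parabolics H → k * u * k⁻¹ ∈ parabolics H := by
    intro k u hu
    refine ⟨?_, ?_⟩
    · intro h
      apply hu.1
      rw [← sl_mem_center_iff] at h ⊢
      have := (inferInstance : (Subgroup.center SL(2, K)).Normal).conj_mem _ h (k : SL(2, K))⁻¹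
      simpa [mul_assoc] using this
    · have hdet := sl_det (k : SL(2, K))
      have : ((k * u * k⁻¹ : H) : SL(2, K)) 0 0 + ((k * u * k⁻¹ : H) : SL(2, K)) 1 1 =
          (u : SL(2, K)) 0 0 + (u : SL(2, K)) 1 1 := by
        obtain ⟨i1, i2, i3, i4⟩ := sl_inv_apply (k : SL(2, K))
        simp only [Subgroup.coe_mul, Subgroup.coe_inv, sl_mul_apply, i1, i2, i3, i4]
        linear_combination ((u : SL(2, K)) 0 0 + (u : SL(2, K)) 1 1) * hdet
      rw [this]; exact hu.2
  refine Nat.card_congr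
    { toFun := fun u => ⟨k⁻¹ * u.1.1 * k, ?_, ?_⟩
      invFun := fun v => ⟨⟨k * v.1 * k⁻¹, hconj k v.1 v.2.1⟩, ?_⟩
      left_inv := fun u => by
        apply Subtype.ext; apply Subtype.ext; simp [mul_assoc]
      right_inv := fun v => by
        apply Subtype.ext; simp [mul_assoc] }
  · simpa using hconj k⁻¹ u.1.1 u.1.2
  · have h1 : y u.1 = k • OnePoint.infty := congrArg Subtype.val u.2
    have h2 := hyu u.1
    rw [h1] at h2
    rw [mul_smul, mul_smul, h2, inv_smul_smul]
  · apply Subtype.ext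
    refine (huniq _ _ ?_).symm
    simp only [mul_smul, inv_smul_smul]
    rw [v.2.2]

theorem card_orbit_infty [IsAlgClosed K] (hp : 5 ≤ p) (h2 : (2 : K) ≠ 0) {H : Subgroup SL(2, K)}
    [Finite H] (hH : -1 ∈ H) (hV : Nat.card (shears H) = p) (hex : ∃ h ∈ H, h 1 0 ≠ 0) :
    Nat.card (MulAction.orbit H (OnePoint.infty : OnePoint K)) = p + 1 := by
  have hfO : Finite (MulAction.orbit H (OnePoint.infty : OnePoint K)) := Set.finite_range _
  set N := Nat.card (MulAction.orbit H (OnePoint.infty : OnePoint K)) with hN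
  obtain ⟨d, hd, hdp, hst⟩ := exists_card_stabilizer_infty h2 hH hV
  obtain ⟨n, x, t, g, hg, ht, hx, hy, -, hsum⟩ := exists_klein_orbits h2 hH
  obtain ⟨b, hb, hb0⟩ := exists_mem_shears_ne_zero hV
  have hos : ∀ y : OnePoint K, Nat.card (MulAction.orbit H y) *
      Nat.card (MulAction.stabilizer H y) = Nat.card H := fun y => by
    rw [← Nat.card_prod]
    exact Nat.card_congr (MulAction.orbitProdStabilizerEquivGroup H y)
  obtain ⟨i₀, hi₀⟩ := hy OnePoint.infty ⟨⟨upperShear b, hb⟩, by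
    rw [sl_eq_one_or_neg_one_iff]; simp [upperShear, hb0], (upperShear_smul_eq_self hb0).2 rfl⟩
  have : Nonempty (MulAction.orbit H (OnePoint.infty : OnePoint K)) :=
    ⟨⟨_, MulAction.mem_orbit_self _⟩⟩
  have hNpos : 0 < N := Nat.card_pos
  have hti : t i₀ = p * d := by
    have h1 := hos (x i₀)
    rw [← MulAction.orbit_eq_iff.2 hi₀, hx, ← hos OnePoint.infty, hst] at h1
    have := Nat.eq_of_mul_eq_mul_left hNpos h1
    omega
  have hgN : g = N * (p * d) := by
    have h1 := hos OnePoint.infty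
    rw [hst, hg, ← hN] at h1
    have : N * (2 * (p * d)) = 2 * (N * (p * d)) := by ring
    omega
  have hN1 : N ≠ 1 := by
    intro h1
    obtain ⟨h, hh, h10⟩ := hex
    have := (Nat.card_eq_one_iff_unique.1 h1).1
    have := Subsingleton.elim
      (⟨(⟨h, hh⟩ : H) • OnePoint.infty, MulAction.mem_orbit _ _⟩ :
        MulAction.orbit H (OnePoint.infty : OnePoint K)) ⟨OnePoint.infty, MulAction.mem_orbit_self _⟩
    exact h10 (sl_smul_infty_eq_self.1 (congrArg Subtype.val this))
  obtain ⟨j, hj⟩ : p ∣ N - 1 := (Nat.modEq_iff_dvd' hNpos).1 (card_orbit_infty_modEq hV).symm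
  have hj1 : 1 ≤ j := by
    rcases Nat.eq_zero_or_pos j with rfl | h
    · omega
    · exact h
  have hNj : N = 1 + p * j := by omega
  have hj : j = 1 := by
    refine eq_one_of_orbit_sum hp hd hdp hj1 i₀ (fun i _ => ht i) hti ?_
    rw [ncard_parabolics h2 hH hV, ← hN, hgN] at hsum
    rw [hNj] at hsum
    push_cast [Nat.cast_sub (show 1 ≤ p by omega)] at hsum
    rw [← hsum]
    have h1 : (p : ℚ) ≠ 0 := by positivity
    have h2 : (d : ℚ) ≠ 0 := by positivity
    have h3 : (1 + p * j : ℚ) ≠ 0 := by positivity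
    field_simp
  rw [hNj, hj]; ring

/-- A finite group containing exactly `p` translations, and not fixing their common fixed point, is
conjugate to a group over the prime field up to scalars. -/
theorem sq_trace_pow_char [IsAlgClosed K] (hp : 5 ≤ p) (h2 : (2 : K) ≠ 0) {H : Subgroup SL(2, K)}
    [Finite H] (hH : -1 ∈ H) (hV : Nat.card (shears H) = p) (hex : ∃ h ∈ H, h 1 0 ≠ 0)
    {h : SL(2, K)} (hh : h ∈ H) : ((h 0 0 + h 1 1) ^ 2) ^ p = (h 0 0 + h 1 1) ^ 2 := by
  have hN := card_orbit_infty hp h2 hH hV hex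
  obtain ⟨m, hm, hm0⟩ := exists_mem_shears_ne_zero hV
  set O := MulAction.orbit H (OnePoint.infty : OnePoint K) with hO
  have hfO : O.Finite := Set.finite_range _
  have hsmul : ∀ g ∈ H, ∀ y ∈ O, g • y ∈ O := fun g hg y hy =>
    MulAction.mem_orbit_of_mem_orbit (⟨g, hg⟩ : H) hy
  have hinfO : OnePoint.infty ∈ O := MulAction.mem_orbit_self _
  have hshear : ∀ b z : K, upperShear b • (z : OnePoint K) = ((z + b : K) : OnePoint K) := by
    intro b z; rw [sl_smul_coe]; simp [upperShear]
  have hadd : ∀ z : K, (z : OnePoint K) ∈ O → ∀ v ∈ shears H, ((z + v : K) : OnePoint K) ∈ O := by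
    intro z hz v hv
    rw [← hshear]; exact hsmul _ hv _ hz
  have hsub : ∀ z w : K, (z : OnePoint K) ∈ O → (w : OnePoint K) ∈ O → z - w ∈ shears H := by
    intro z w hz hw
    have hinj : Function.Injective fun v : shears H => ((w + v : K) : OnePoint K) := by
      intro a b hab
      exact Subtype.ext (add_left_cancel (OnePoint.coe_injective hab))
    have heq : Set.range (fun v : shears H => ((w + v : K) : OnePoint K)) = O \ {OnePoint.infty} := by
      refine Set.eq_of_subset_of_ncard_le ?_ ?_ (hfO.subset Set.sdiff_subset)
      · rintro _ ⟨v, rfl⟩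
        exact ⟨hadd w hw v v.2, by simp⟩
      · rw [Set.ncard_sdiff_singleton_of_mem hinfO, ← Nat.card_coe_set_eq O, hN, ← Set.image_univ,
          Set.ncard_image_of_injective _ hinj, Set.ncard_univ, hV]
        omega
    obtain ⟨v, hv⟩ := heq ▸ (show (z : OnePoint K) ∈ O \ {OnePoint.infty} from ⟨hz, by simp⟩)
    have : w + v = z := OnePoint.coe_injective hv
    rw [← this, add_sub_cancel_left]; exact v.2
  have hdet := sl_det h
  by_cases hc : h 1 0 = 0
  · have ha := div_pow_eq_of_mem_shears hV (sq_mul_mem_shears hh hc hm) hm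
    rw [mul_div_cancel_right₀ _ hm0] at ha
    have h0 : h 0 0 ≠ 0 := by rintro h0; rw [h0, hc] at hdet; simp at hdet
    have hd : h 1 1 = (h 0 0)⁻¹ := by
      rw [hc] at hdet; exact eq_inv_of_mul_eq_one_right (by linear_combination hdet)
    have : (h 0 0 + h 1 1) ^ 2 = (h 0 0) ^ 2 + 2 + ((h 0 0) ^ 2)⁻¹ := by
      rw [hd]; field_simp; ring
    rw [this, ← frobenius_def, map_add, map_add, map_inv₀, frobenius_def, ha, map_ofNat]
  · have h1 : ((h 0 0 / h 1 0 : K) : OnePoint K) ∈ O := by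
      have := hsmul h hh _ hinfO
      rwa [sl_smul_infty, if_neg hc] at this
    have h2 : ((-h 1 1 / h 1 0 : K) : OnePoint K) ∈ O := by
      have := hsmul _ (H.inv_mem hh) _ hinfO
      obtain ⟨i1, i2, i3, i4⟩ := sl_inv_apply h
      rw [sl_smul_infty, i1, i3, if_neg (neg_ne_zero.2 hc), div_neg, ← neg_div] at this
      exact this
    have h3 := hsmul h hh _ (hadd _ h2 m hm)
    have hden : h 1 0 * (-h 1 1 / h 1 0 + m) + h 1 1 = h 1 0 * m := by field_simp; ring
    rw [sl_smul_coe, hden, if_neg (mul_ne_zero hc hm0)] at h3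
    have hv := hsub _ _ h1 h2
    have hw := hsub _ _ h1 h3
    have hw' : h 0 0 / h 1 0 - (h 0 0 * (-h 1 1 / h 1 0 + m) + h 0 1) / (h 1 0 * m) =
        1 / (h 1 0 ^ 2 * m) := by
      field_simp
      linear_combination hdet
    rw [hw'] at hw
    have e1 := div_pow_eq_of_mem_shears hV hv hm
    have e2 := div_pow_eq_of_mem_shears hV hv hw
    have : (h 0 0 + h 1 1) ^ 2 = (h 0 0 / h 1 0 - -h 1 1 / h 1 0) / m *
        ((h 0 0 / h 1 0 - -h 1 1 / h 1 0) / (1 / (h 1 0 ^ 2 * m))) := by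
      field_simp
      ring
    rw [this, mul_pow, e1, e2]

end Parabolic

section Generation
variable {F : Type*} [Field F]

theorem sl_trace_conj (k g : SL(2, F)) :
    (k⁻¹ * g * k) 0 0 + (k⁻¹ * g * k) 1 1 = g 0 0 + g 1 1 := by
  have hdet := sl_det k
  obtain ⟨i1, i2, i3, i4⟩ := sl_inv_apply k
  simp only [sl_mul_apply, i1, i2, i3, i4]
  linear_combination (g 0 0 + g 1 1) * hdet

theorem exists_sl_smul_infty_eq [DecidableEq F] (y : OnePoint F) :
    ∃ k : SL(2, F), k • (OnePoint.infty : OnePoint F) = y := by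
  cases y with
  | infty => exact ⟨1, one_smul _ _⟩
  | coe z =>
    let k : SL(2, F) := ⟨!![z, -1; 1, 0], by simp⟩
    refine ⟨k, (sl_smul_infty k).trans ?_⟩
    simp [k]

/-- A subgroup of `SL(2, F)` containing all translations and moving their fixed point is
everything. -/
theorem eq_top_of_forall_upperShear_mem {G : Subgroup SL(2, F)} (hG : ∀ b, upperShear b ∈ G)
    (hex : ∃ h ∈ G, h 1 0 ≠ 0) : G = ⊤ := by
  obtain ⟨h, hh, hc⟩ := hex
  let L : F → SL(2, F) := fun t => ⟨!![1, 0; t, 1], by simp⟩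
  have hL : ∀ t, L t ∈ G := by
    intro t
    let w := upperShear (-h 0 0 / h 1 0) * h * upperShear (-h 1 1 / h 1 0)
    have hw : w ∈ G := G.mul_mem (G.mul_mem (hG _) hh) (hG _)
    have hdet := sl_det h
    have w00 : w 0 0 = 0 := by
      simp only [w, sl_mul_apply]; simp [upperShear]; field_simp; ring
    have w01 : w 0 1 = -1 / h 1 0 := by
      simp only [w, sl_mul_apply]; simp [upperShear]; field_simp; linear_combination -hdet
    have w10 : w 1 0 = h 1 0 := by
      simp only [w, sl_mul_apply]; simp [upperShear]
    have w11 : w 1 1 = 0 := by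
      simp only [w, sl_mul_apply]; simp [upperShear]; field_simp; ring
    have : L t = w * upperShear (-t / h 1 0 ^ 2) * w⁻¹ := by
      obtain ⟨i1, i2, i3, i4⟩ := sl_inv_apply w
      apply sl_ext <;> simp only [sl_mul_apply, i1, i2, i3, i4, w00, w01, w10, w11] <;>
        simp [upperShear, L] <;> field_simp
    rw [this]
    exact G.mul_mem (G.mul_mem hw (hG _)) (G.inv_mem hw)
  have key : ∀ g : SL(2, F), g 1 0 ≠ 0 → g ∈ G := by
    intro g hg
    have hdet := sl_det g
    have : g = upperShear ((g 0 0 - 1) / g 1 0) * L (g 1 0) * upperShear ((g 1 1 - 1) / g 1 0) := by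
      apply sl_ext <;> simp only [sl_mul_apply] <;> simp [upperShear, L] <;> field_simp
      · ring
      · linear_combination -hdet
      · ring
    rw [this]
    exact G.mul_mem (G.mul_mem (hG _) (hL _)) (hG _)
  rw [eq_top_iff]
  intro g _
  by_cases hg : g 1 0 = 0
  · have hdet := sl_det g
    have h11 : g 1 1 ≠ 0 := by rintro h0; rw [hg, h0] at hdet; simp at hdet
    have : g * L 1 ∈ G := key _ (by simp only [sl_mul_apply]; simp [L, hg, h11])
    exact (G.mul_mem_cancel_right (hL 1)).1 this
  · exact key g hg

theorem card_shears_map {K : Type*} [Field K] (f : F →+* K) (G : Subgroup SL(2, F)) :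
    Nat.card (shears (G.map (Matrix.SpecialLinearGroup.map f))) = Nat.card (shears G) := by
  have hf : ∀ b, Matrix.SpecialLinearGroup.map f (upperShear b) = upperShear (f b) := by
    intro b
    apply sl_ext <;> rw [Matrix.SpecialLinearGroup.map_apply_coe] <;> simp [upperShear]
  refine (Nat.card_congr (Equiv.ofBijective (fun b : shears G =>
    (⟨f b, mem_shears.2 (hf b ▸ Subgroup.mem_map_of_mem _ (mem_shears.1 b.2))⟩ :
      shears (G.map (Matrix.SpecialLinearGroup.map f)))) ⟨?_, ?_⟩)).symm
  · intro a b hab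
    exact Subtype.ext (f.injective (congrArg Subtype.val hab))
  · rintro ⟨b, hb⟩
    obtain ⟨g, hg, hgb⟩ := Subgroup.mem_map.1 (mem_shears.1 hb)
    have he : ∀ i j, f (g i j) = upperShear b i j := fun i j => by rw [← hgb]; simp
    have h00 := he 0 0
    have h01 := he 0 1
    have h10 := he 1 0
    have h11 := he 1 1
    simp only [upperShear, Matrix.of_apply, Matrix.cons_val', Matrix.cons_val_zero,
      Matrix.cons_val_one, Matrix.cons_val_fin_one] at h00 h01 h10 h11
    have : g = upperShear (g 0 1) := by
      apply sl_ext <;> simp [upperShear]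
      · exact f.injective (by rw [h00, map_one])
      · exact f.injective (by rw [h10, map_zero])
      · exact f.injective (by rw [h11, map_one])
    exact ⟨⟨g 0 1, mem_shears.2 (this ▸ hg)⟩, Subtype.ext h01⟩

variable {p : ℕ} [Fact p.Prime] [CharP F p]

theorem eq_top_of_upperShear_mem [Finite F] (hp : 5 ≤ p) {G : Subgroup SL(2, F)}
    (hF : Nat.card F = p ∨ Nat.card F = p ^ 2 ∧
      ∃ g ∈ G, ((g 0 0 + g 1 1) ^ 2) ^ p ≠ (g 0 0 + g 1 1) ^ 2)
    (hG : -1 ∈ G) {b : F} (hb : b ≠ 0) (hbG : upperShear b ∈ G) (hex : ∃ h ∈ G, h 1 0 ≠ 0) :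
    G = ⊤ := by
  classical
  have hpp : p.Prime := Fact.out
  have hdvd := (shears G).card_addSubgroup_dvd_card
  have hne : Nat.card (shears G) ≠ 1 := by
    intro h
    have := (Nat.card_eq_one_iff_unique.1 h).1
    exact hb (congrArg Subtype.val (Subsingleton.elim (⟨b, hbG⟩ : shears G) 0))
  have htop : Nat.card (shears G) = Nat.card F → G = ⊤ := by
    intro h
    have := AddSubgroup.eq_top_of_card_eq _ h
    exact eq_top_of_forall_upperShear_mem
      (fun b => mem_shears.1 (this ▸ AddSubgroup.mem_top b)) hex
  rcases hF with hF | ⟨hF, g, hg, hgp⟩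
  · rw [hF] at hdvd htop
    exact htop ((hpp.eq_one_or_self_of_dvd _ hdvd).resolve_left hne)
  · obtain ⟨i, hi, hi'⟩ := (Nat.dvd_prime_pow hpp).1 (hF ▸ hdvd)
    interval_cases i
    · exact absurd hi' (by simpa using hne)
    · exfalso
      rw [pow_one] at hi'
      have : CharP (AlgebraicClosure F) p := charP_of_injective_algebraMap
        (algebraMap F (AlgebraicClosure F)).injective p
      have h2 : (2 : AlgebraicClosure F) ≠ 0 := by
        intro h
        have := (CharP.cast_eq_zero_iff (AlgebraicClosure F) p 2).1 (by exact_mod_cast h)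
        exact absurd (Nat.le_of_dvd (by norm_num) this) (by omega)
      let f := algebraMap F (AlgebraicClosure F)
      let H := G.map (Matrix.SpecialLinearGroup.map f)
      have hfin : Finite H := Set.Finite.image _ (Set.toFinite (G : Set SL(2, F)))
      have hH : -1 ∈ H := ⟨-1, hG, by apply sl_ext <;> simp⟩
      obtain ⟨h, hh, hc⟩ := hex
      have hV : Nat.card (shears H) = p := (card_shears_map f G).trans hi'
      have := sq_trace_pow_char hp h2 (H := H) hH hV ⟨_, Subgroup.mem_map_of_mem _ hh, by
        simpa using hc⟩ (Subgroup.mem_map_of_mem _ hg)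
      apply hgp
      apply f.injective
      simpa using this
    · exact htop (hi'.trans hF.symm)

theorem eq_top_of_parabolic_mem [Finite F] [DecidableEq F] (hp : 5 ≤ p) {G : Subgroup SL(2, F)}
    (hF : Nat.card F = p ∨ Nat.card F = p ^ 2 ∧
      ∃ g ∈ G, ((g 0 0 + g 1 1) ^ 2) ^ p ≠ (g 0 0 + g 1 1) ^ 2)
    (hG : -1 ∈ G) (hfix : ∀ y : OnePoint F, ∃ h ∈ G, h • y ≠ y) {u : SL(2, F)} (hu : u ∈ G)
    (hu1 : ¬ (u = 1 ∨ u = -1)) (ht : (u 0 0 + u 1 1) ^ 2 = 4) : G = ⊤ := by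
  have h2 : (2 : F) ≠ 0 := by
    intro h
    have := (CharP.cast_eq_zero_iff F p 2).1 (by exact_mod_cast h)
    exact absurd (Nat.le_of_dvd (by norm_num) this) (by omega)
  obtain ⟨y, hy⟩ := Set.ncard_eq_one.1 (sl_fixedBy_ncard_of_parabolic h2 hu1 ht)
  have huy : u • y = y := by
    have : y ∈ MulAction.fixedBy (OnePoint F) u := hy ▸ Set.mem_singleton y
    exact this
  obtain ⟨k, rfl⟩ := exists_sl_smul_infty_eq y
  let c := MulAut.conj k
  let G' := G.comap c.toMonoidHom
  have hmem : ∀ g ∈ G, k⁻¹ * g * k ∈ G' := by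
    intro g hg
    change k * (k⁻¹ * g * k) * k⁻¹ ∈ G
    simpa [mul_assoc] using hg
  have hG' : -1 ∈ G' := by simpa using hmem _ hG
  suffices h : G' = ⊤ by
    rw [eq_top_iff]
    intro g _
    have : k⁻¹ * g * k ∈ G' := h ▸ Subgroup.mem_top _
    change k * (k⁻¹ * g * k) * k⁻¹ ∈ G at this
    simpa [mul_assoc] using this
  have key : ∀ w ∈ G', ¬ (w = 1 ∨ w = -1) → w 0 0 + w 1 1 = 2 → w 1 0 = 0 →
      ∃ b ≠ 0, upperShear b ∈ G' := by
    intro w hw hw1 htr h10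
    rw [sl_eq_one_or_neg_one_iff] at hw1
    have hdet := sl_det w
    have h00 : w 0 0 = 1 := by
      have : (w 0 0 - 1) ^ 2 = 0 := by
        rw [h10] at hdet; linear_combination w 0 0 * htr - hdet
      exact sub_eq_zero.1 (pow_eq_zero_iff two_ne_zero |>.1 this)
    have h11 : w 1 1 = 1 := by linear_combination htr - h00
    refine ⟨w 0 1, fun h => hw1 ⟨h, h10, h00.trans h11.symm⟩, ?_⟩
    have : upperShear (w 0 1) = w := by
      apply sl_ext <;> simp [upperShear, h10, h00, h11]
    rwa [this]
  have hv10 : (k⁻¹ * u * k) 1 0 = 0 := by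
    rw [← sl_smul_infty_eq_self, mul_smul, mul_smul, huy, inv_smul_smul]
  have hv1 : ¬ (k⁻¹ * u * k = 1 ∨ k⁻¹ * u * k = -1) := by
    intro h
    apply hu1
    rw [← sl_mem_center_iff] at h ⊢
    have := (inferInstance : (Subgroup.center SL(2, F)).Normal).conj_mem _ h k
    simpa [mul_assoc] using this
  have hvt := sl_trace_conj k u
  obtain ⟨b, hb, hbG⟩ : ∃ b ≠ 0, upperShear b ∈ G' := by
    have : (u 0 0 + u 1 1 - 2) * (u 0 0 + u 1 1 + 2) = 0 := by linear_combination ht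
    rcases mul_eq_zero.1 this with h | h
    · exact key _ (hmem u hu) hv1 (by linear_combination hvt + h) hv10
    · refine key _ (G'.mul_mem hG' (hmem u hu)) ?_ ?_ ?_
      · rintro (h | h)
        · exact hv1 (Or.inr (by rw [neg_one_mul, neg_eq_iff_eq_neg] at h; exact h))
        · exact hv1 (Or.inl (by rw [neg_one_mul, neg_inj] at h; exact h))
      · rw [neg_one_mul]; simp only [Matrix.SpecialLinearGroup.coe_neg, Matrix.neg_apply]
        linear_combination -hvt - h
      · rw [neg_one_mul]; simp only [Matrix.SpecialLinearGroup.coe_neg, Matrix.neg_apply]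
        rw [hv10, neg_zero]
  refine eq_top_of_upperShear_mem hp (hF.imp_right fun h => ⟨h.1, ?_⟩) hG' hb hbG ?_
  · obtain ⟨-, g, hg, hgp⟩ := h
    refine ⟨_, hmem g hg, ?_⟩
    rwa [sl_trace_conj]
  · obtain ⟨h, hh, hne⟩ := hfix (k • OnePoint.infty)
    refine ⟨_, hmem h hh, fun h0 => hne ?_⟩
    rw [← sl_smul_infty_eq_self, mul_smul, mul_smul, inv_smul_eq_iff] at h0
    exact h0

end Generation

section Triple
variable {F : Type*} [Field F]

theorem sl_pow_add_two (g : SL(2, F)) (n : ℕ) (i j : Fin 2) :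
    (g ^ (n + 2)) i j = (g 0 0 + g 1 1) * (g ^ (n + 1)) i j - (g ^ n) i j := by
  have hdet := sl_det g
  rw [show n + 2 = n + 1 + 1 from rfl, pow_succ g (n + 1), sl_mul_apply, pow_succ g n]
  simp only [sl_mul_apply]
  fin_cases j <;> simp only [Fin.zero_eta, Fin.mk_one]
  · linear_combination (-(g ^ n) i 0) * hdet
  · linear_combination (-(g ^ n) i 1) * hdet

theorem sl_pow_two_apply (g : SL(2, F)) (i j : Fin 2) :
    (g ^ 2) i j = (g 0 0 + g 1 1) * g i j - (1 : SL(2, F)) i j := by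
  have h0 := sl_pow_add_two g 0 i j
  simpa using h0

theorem sl_pow_three_apply (g : SL(2, F)) (i j : Fin 2) :
    (g ^ 3) i j = ((g 0 0 + g 1 1) ^ 2 - 1) * g i j - (g 0 0 + g 1 1) * (1 : SL(2, F)) i j := by
  have h0 := sl_pow_two_apply g i j
  have h1 := sl_pow_add_two g 1 i j
  simp only [Nat.reduceAdd, pow_one] at h1
  linear_combination h1 + (g 0 0 + g 1 1) * h0

theorem sl_pow_four_apply (g : SL(2, F)) (i j : Fin 2) :
    (g ^ 4) i j = ((g 0 0 + g 1 1) ^ 3 - 2 * (g 0 0 + g 1 1)) * g i j -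
      ((g 0 0 + g 1 1) ^ 2 - 1) * (1 : SL(2, F)) i j := by
  have h0 := sl_pow_two_apply g i j
  have h1 := sl_pow_three_apply g i j
  have h2 := sl_pow_add_two g 2 i j
  simp only [Nat.reduceAdd] at h2
  linear_combination h2 + (g 0 0 + g 1 1) * h1 - h0

theorem sl_pow_five_apply (g : SL(2, F)) (i j : Fin 2) :
    (g ^ 5) i j = ((g 0 0 + g 1 1) ^ 4 - 3 * (g 0 0 + g 1 1) ^ 2 + 1) * g i j -
      ((g 0 0 + g 1 1) ^ 3 - 2 * (g 0 0 + g 1 1)) * (1 : SL(2, F)) i j := by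
  have h0 := sl_pow_three_apply g i j
  have h1 := sl_pow_four_apply g i j
  have h2 := sl_pow_add_two g 3 i j
  simp only [Nat.reduceAdd] at h2
  linear_combination h2 + (g 0 0 + g 1 1) * h1 - h0

theorem sl_pow_six_apply (g : SL(2, F)) (i j : Fin 2) :
    (g ^ 6) i j = ((g 0 0 + g 1 1) ^ 5 - 4 * (g 0 0 + g 1 1) ^ 3 + 3 * (g 0 0 + g 1 1)) * g i j -
      ((g 0 0 + g 1 1) ^ 4 - 3 * (g 0 0 + g 1 1) ^ 2 + 1) * (1 : SL(2, F)) i j := by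
  have h0 := sl_pow_four_apply g i j
  have h1 := sl_pow_five_apply g i j
  have h2 := sl_pow_add_two g 4 i j
  simp only [Nat.reduceAdd] at h2
  linear_combination h2 + (g 0 0 + g 1 1) * h1 - h0

theorem sl_eq_zero_of_scalar {g h : SL(2, F)} (hg : ¬ (g = 1 ∨ g = -1)) {u v : F}
    (hh : ∀ i j, h i j = u * g i j - v * (1 : SL(2, F)) i j) (h1 : h = 1 ∨ h = -1) : u = 0 := by
  rw [sl_eq_one_or_neg_one_iff] at hg h1
  by_contra hu
  obtain ⟨h01, h10, h00⟩ := h1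
  rw [hh] at h01 h10
  rw [hh, hh] at h00
  simp only [Matrix.SpecialLinearGroup.coe_one, Matrix.one_apply_eq, ne_eq, one_ne_zero,
    zero_ne_one, not_false_eq_true, Matrix.one_apply_ne, mul_zero, sub_zero, mul_eq_zero, hu,
    false_or, sub_left_inj, mul_eq_mul_left_iff, or_false] at h01 h10 h00
  exact hg ⟨h01, h10, h00⟩

theorem sl_sq_eq_one_or (h : SL(2, F)) (h1 : h ^ 2 = 1) (h2 : (2 : F) ≠ 0) : h = 1 ∨ h = -1 := by
  by_contra hc
  have ht := sl_eq_zero_of_scalar (u := h 0 0 + h 1 1) (v := 1) hc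
    (fun i j => by rw [one_mul]; exact sl_pow_two_apply h i j) (Or.inl h1)
  have := sl_pow_two_apply h 0 0
  rw [h1, ht] at this
  simp at this
  exact h2 (by linear_combination this)

/-- Triples of matrices satisfying the relations of the tetrahedral group up to sign. -/
structure TetTriple (τ x : F) (A B C : SL(2, F)) : Prop where
  tau : τ ^ 2 = τ + 1
  trA : A 0 0 + A 1 1 = 1
  trB : B 0 0 + B 1 1 = τ
  trC : C 0 0 + C 1 1 = 1
  trAB : (A * B) 0 0 + (A * B) 1 1 = 0
  trBC : (B * C) 0 0 + (B * C) 1 1 = 0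
  trABC : (A * B * C) 0 0 + (A * B * C) 1 1 = 0
  trAC : (A * C) 0 0 + (A * C) 1 1 = x

namespace TetTriple
variable {τ x : F} {A B C : SL(2, F)}

theorem map {K : Type*} [Field K] (f : F →+* K) (T : TetTriple τ x A B C) :
    TetTriple (f τ) (f x) (Matrix.SpecialLinearGroup.map f A) (Matrix.SpecialLinearGroup.map f B)
      (Matrix.SpecialLinearGroup.map f C) := by
  have key : ∀ {g : SL(2, F)} {t : F}, g 0 0 + g 1 1 = t →
      Matrix.SpecialLinearGroup.map f g 0 0 + Matrix.SpecialLinearGroup.map f g 1 1 = f t := by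
    rintro g _ rfl
    rw [Matrix.SpecialLinearGroup.map_apply_coe]
    simp
  constructor
  · rw [← map_pow, T.tau, map_add, map_one]
  · simpa only [map_one] using key T.trA
  · exact key T.trB
  · simpa only [map_one] using key T.trC
  · simpa only [map_mul, map_zero] using key T.trAB
  · simpa only [map_mul, map_zero] using key T.trBC
  · simpa only [map_mul, map_zero] using key T.trABC
  · simpa only [map_mul] using key T.trAC

/-- Fricke's relation between the traces. -/
theorem fricke (T : TetTriple τ x A B C) : x ^ 2 - x + τ - 1 = 0 := by
  have hA := sl_det A
  have hB := sl_det B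
  have hC := sl_det C
  have key : ((A * B * C) 0 0 + (A * B * C) 1 1) * ((A * C * B) 0 0 + (A * C * B) 1 1) =
      (A 0 0 + A 1 1) ^ 2 * (B 0 0 * B 1 1 - B 0 1 * B 1 0) * (C 0 0 * C 1 1 - C 0 1 * C 1 0) +
      (B 0 0 + B 1 1) ^ 2 * (A 0 0 * A 1 1 - A 0 1 * A 1 0) * (C 0 0 * C 1 1 - C 0 1 * C 1 0) +
      (C 0 0 + C 1 1) ^ 2 * (A 0 0 * A 1 1 - A 0 1 * A 1 0) * (B 0 0 * B 1 1 - B 0 1 * B 1 0) +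
      ((A * B) 0 0 + (A * B) 1 1) ^ 2 * (C 0 0 * C 1 1 - C 0 1 * C 1 0) +
      ((B * C) 0 0 + (B * C) 1 1) ^ 2 * (A 0 0 * A 1 1 - A 0 1 * A 1 0) +
      ((A * C) 0 0 + (A * C) 1 1) ^ 2 * (B 0 0 * B 1 1 - B 0 1 * B 1 0) -
      (A 0 0 + A 1 1) * (B 0 0 + B 1 1) * ((A * B) 0 0 + (A * B) 1 1) *
        (C 0 0 * C 1 1 - C 0 1 * C 1 0) -
      (B 0 0 + B 1 1) * (C 0 0 + C 1 1) * ((B * C) 0 0 + (B * C) 1 1) *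
        (A 0 0 * A 1 1 - A 0 1 * A 1 0) -
      (A 0 0 + A 1 1) * (C 0 0 + C 1 1) * ((A * C) 0 0 + (A * C) 1 1) *
        (B 0 0 * B 1 1 - B 0 1 * B 1 0) +
      ((A * B) 0 0 + (A * B) 1 1) * ((B * C) 0 0 + (B * C) 1 1) * ((A * C) 0 0 + (A * C) 1 1) -
      4 * (A 0 0 * A 1 1 - A 0 1 * A 1 0) * (B 0 0 * B 1 1 - B 0 1 * B 1 0) *
        (C 0 0 * C 1 1 - C 0 1 * C 1 0) := by
    simp only [sl_mul_apply]
    ring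
  rw [T.trABC, hA, hB, hC, T.trA, T.trB, T.trC, T.trAB, T.trBC, T.trAC] at key
  linear_combination -key - T.tau

theorem pow_three (T : TetTriple τ x A B C) : A ^ 3 = -1 := by
  have h := sl_pow_three_apply A
  rw [T.trA] at h
  apply sl_ext <;> rw [h] <;> simp

theorem pow_five (T : TetTriple τ x A B C) : B ^ 5 = -1 := by
  have h := sl_pow_five_apply B
  rw [T.trB] at h
  have h1 : τ ^ 4 - 3 * τ ^ 2 + 1 = 0 := by linear_combination (τ ^ 2 + τ - 1) * T.tau
  have h2 : τ ^ 3 - 2 * τ = 1 := by linear_combination (τ + 1) * T.tau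
  rw [h1, h2] at h
  apply sl_ext <;> rw [h] <;> simp

theorem pow_two (T : TetTriple τ x A B C) : (A * B) ^ 2 = -1 := by
  have h := sl_pow_two_apply (A * B)
  rw [T.trAB] at h
  apply sl_ext <;> rw [h] <;> simp

theorem tau_ne (T : TetTriple τ x A B C) : τ ≠ 0 ∧ τ ≠ 1 ∧ τ ≠ -1 := by
  have := T.tau
  refine ⟨?_, ?_, ?_⟩ <;> rintro rfl <;> apply one_ne_zero (α := F)
  · linear_combination -this
  · linear_combination -this
  · linear_combination this

theorem neg_one_mem (T : TetTriple τ x A B C) {G : Subgroup SL(2, F)} (hA : A ∈ G) : -1 ∈ G :=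
  T.pow_three ▸ G.pow_mem hA 3

theorem no_fixed_point [DecidableEq F] (T : TetTriple τ x A B C) {y : OnePoint F}
    (hA : A • y = y) (hB : B • y = y) : False := by
  obtain ⟨k, rfl⟩ := exists_sl_smul_infty_eq y
  have hA0 : (k⁻¹ * A * k) 1 0 = 0 := by
    rw [← sl_smul_infty_eq_self, mul_smul, mul_smul, hA, inv_smul_smul]
  have hB0 : (k⁻¹ * B * k) 1 0 = 0 := by
    rw [← sl_smul_infty_eq_self, mul_smul, mul_smul, hB, inv_smul_smul]
  have tA := sl_trace_conj k A
  have tB := sl_trace_conj k B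
  have tAB := sl_trace_conj k (A * B)
  rw [show k⁻¹ * (A * B) * k = (k⁻¹ * A * k) * (k⁻¹ * B * k) by group] at tAB
  rw [T.trA] at tA
  rw [T.trB] at tB
  rw [T.trAB] at tAB
  generalize k⁻¹ * A * k = A' at *
  generalize k⁻¹ * B * k = B' at *
  have dA := sl_det A'
  have dB := sl_det B'
  simp only [sl_mul_apply, hA0, hB0, mul_zero, sub_zero, add_zero, zero_mul, zero_add]
    at dA dB tAB
  have h1 : A' 1 1 = 1 - A' 0 0 := by linear_combination tA
  have h2 : B' 1 1 = τ - B' 0 0 := by linear_combination tB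
  rw [h1] at dA tAB
  rw [h2] at dB tAB
  have ht := T.tau
  have h4 : τ ^ 2 = 3 := by
    generalize A' 0 0 = a at *
    generalize B' 0 0 = b at *
    have e1 : a ^ 2 = a - 1 := by linear_combination -dA
    have e2 : b ^ 2 = τ * b - 1 := by linear_combination -dB
    have e3 : (2 * a - 1) * b = (a - 1) * τ := by linear_combination tAB
    have e4 : (2 * a - 1) ^ 2 * b ^ 2 = (a - 1) ^ 2 * τ ^ 2 := by
      linear_combination ((2 * a - 1) * b + (a - 1) * τ) * e3
    rw [e2] at e4
    linear_combination (-1) * e4 + (2 * a - 1) * τ * e3 - (4 - τ ^ 2) * e1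
  have h5 : τ = 2 := by linear_combination h4 - ht
  rw [h5] at h4
  exact one_ne_zero (α := F) (by linear_combination h4)

theorem not_scalar (T : TetTriple τ x A B C) (h2 : (2 : F) ≠ 0) (h3 : (3 : F) ≠ 0)
    (h5 : (5 : F) ≠ 0) :
    ¬ (A = 1 ∨ A = -1) ∧ ¬ (B = 1 ∨ B = -1) ∧ ¬ (A * B = 1 ∨ A * B = -1) := by
  have key : ∀ g : SL(2, F), g = 1 ∨ g = -1 → (g 0 0 + g 1 1) ^ 2 = 4 := by
    rintro g (rfl | rfl) <;> simp <;> norm_num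
  have ht := T.tau
  refine ⟨fun h => ?_, fun h => ?_, fun h => ?_⟩ <;> have := key _ h
  · rw [T.trA] at this; exact h3 (by linear_combination -this)
  · rw [T.trB] at this
    have h' : τ = 3 := by linear_combination this - ht
    rw [h'] at this
    exact h5 (by linear_combination this)
  · rw [T.trAB] at this
    exact mul_ne_zero h2 h2 (by linear_combination -this)

theorem sixty_dvd_card (T : TetTriple τ x A B C) (h2 : (2 : F) ≠ 0) (h3 : (3 : F) ≠ 0)
    (h5 : (5 : F) ≠ 0) {G : Subgroup SL(2, F)} (hA : A ∈ G) (hB : B ∈ G) :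
    60 ∣ Nat.card G := by
  obtain ⟨nA, nB, nAB⟩ := T.not_scalar h2 h3 h5
  have key : ∀ {g : SL(2, F)} {q k : ℕ} [Fact q.Prime], g ∈ G → ¬ g ^ q ^ k = 1 →
      g ^ q ^ (k + 1) = 1 → q ^ (k + 1) ∣ Nat.card G := fun {g q k} _ hg h1 h2 => by
    rw [← orderOf_eq_prime_pow h1 h2]
    exact Subgroup.orderOf_dvd_natCard _ hg
  have h3 : 3 ^ 1 ∣ Nat.card G := by
    have : Fact (Nat.Prime 3) := ⟨by norm_num⟩
    refine key (k := 0) (G.pow_mem hA 2) (fun h => nA (sl_sq_eq_one_or A (by simpa using h) h2)) ?_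
    simp only [zero_add, pow_one]
    rw [← pow_mul, mul_comm, pow_mul, T.pow_three]; simp
  have h5 : 5 ^ 1 ∣ Nat.card G := by
    have : Fact (Nat.Prime 5) := ⟨by norm_num⟩
    refine key (k := 0) (G.pow_mem hB 2) (fun h => nB (sl_sq_eq_one_or B (by simpa using h) h2)) ?_
    simp only [zero_add, pow_one]
    rw [← pow_mul, mul_comm, pow_mul, T.pow_five]; simp
  have h4 : 2 ^ 2 ∣ Nat.card G := by
    have : Fact (Nat.Prime 2) := ⟨by norm_num⟩
    refine key (k := 1) (G.mul_mem hA hB)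
      (fun h => nAB (sl_sq_eq_one_or _ (by simpa using h) h2)) ?_
    rw [show 2 ^ (1 + 1) = 2 * 2 from rfl, pow_mul, T.pow_two]; simp
  omega

theorem order_ne (T : TetTriple τ x A B C) (h2 : (2 : F) ≠ 0) (h3 : (3 : F) ≠ 0) :
    ¬ ((A * C) ^ 4 = 1 ∨ (A * C) ^ 6 = 1 ∨ (A * C) ^ 10 = 1) := by
  have hf := T.fricke
  have ht := T.tau
  have hx' := T.trAC
  obtain ⟨t0, t1, t1'⟩ := T.tau_ne
  have hM : ¬ (A * C = 1 ∨ A * C = -1) := by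
    have hAC : ¬ A * C = 1 := by
      intro h
      rw [h] at hx'
      simp only [Matrix.SpecialLinearGroup.coe_one, Matrix.one_apply_eq] at hx'
      rw [← hx'] at hf
      exact t1' (by linear_combination hf)
    rintro (h | h)
    · exact hAC h
    · have hC : C = A⁻¹ * -1 := by rw [← h]; simp
      have := T.trC
      obtain ⟨i1, i2, i3, i4⟩ := sl_inv_apply A
      rw [hC] at this
      simp only [sl_mul_apply, i1, i2, i3, i4] at this
      simp at this
      exact h2 (by linear_combination -this - T.trA)
  have key : ∀ y : F, y = 0 ∨ y = 1 ∨ y ^ 2 - 3 * y + 1 = 0 → x ^ 2 ≠ y := by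
    rintro y (rfl | rfl | hy) hxy
    · have : x = 0 := by simpa using hxy
      rw [this] at hf
      exact t1 (by linear_combination hf)
    · have h : (x - 1) * (x + 1) = 0 := by linear_combination hxy
      rcases mul_eq_zero.1 h with h | h
      · exact t1 (by linear_combination hf - x * h)
      · exact t1' (by linear_combination hf - (x - 2) * h)
    · rw [← hxy] at hy
      have h : (x ^ 2 - x - 1) * (x ^ 2 + x - 1) = 0 := by linear_combination hy
      rcases mul_eq_zero.1 h with h | h
      · exact t0 (by linear_combination hf - h)
      · have e1 : τ = 2 * x := by linear_combination hf - h
        have e2 : 3 * (1 - 2 * x) = 0 := by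
          rw [e1] at ht; linear_combination ht - 4 * h
        have e3 := (mul_eq_zero.1 e2).resolve_left h3
        exact t1 (by linear_combination e1 - e3)
  have z := fun {h : SL(2, F)} {u v : F} => sl_eq_zero_of_scalar (h := h) (u := u) (v := v) hM
  rintro (h | h | h)
  · have hp := sl_pow_four_apply (A * C)
    rw [hx'] at hp
    have hu := z hp (Or.inl h)
    have := hp 0 0
    rw [h, hu] at this
    simp at this
    exact key _ (Or.inl rfl) (by linear_combination this)
  · have hp := sl_pow_six_apply (A * C)
    rw [hx'] at hp
    have hu := z hp (Or.inl h)
    have := hp 0 0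
    rw [h, hu] at this
    simp at this
    have e : x ^ 2 * (x ^ 2 * (x ^ 2 - 4) + 3) = 0 := by linear_combination x * hu
    have e' : x ^ 4 - 3 * x ^ 2 + 2 = 0 := by linear_combination this
    have e2 : x ^ 2 = 1 ∨ x ^ 2 = 2 := by
      have : (x ^ 2 - 1) * (x ^ 2 - 2) = 0 := by linear_combination e'
      rcases mul_eq_zero.1 this with h | h
      · left; linear_combination h
      · right; linear_combination h
    rcases e2 with h | h
    · exact key _ (Or.inr (Or.inl rfl)) h
    · rw [h] at e
      exact h2 (by linear_combination -e)
  · have h5 : (A * C) ^ 5 = 1 ∨ (A * C) ^ 5 = -1 :=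
      sl_sq_eq_one_or _ (by rw [← pow_mul]; exact h) h2
    have hp := sl_pow_five_apply (A * C)
    rw [hx'] at hp
    have hu := z hp h5
    exact key (x ^ 2) (Or.inr (Or.inr (by linear_combination hu))) rfl

theorem generates [Finite F] {p : ℕ} [Fact p.Prime] [CharP F p] (hp : 7 ≤ p)
    (T : TetTriple τ x A B C) (hF : Nat.card F = p ∨ Nat.card F = p ^ 2 ∧ (x ^ 2) ^ p ≠ x ^ 2)
    {G : Subgroup SL(2, F)} (hA : A ∈ G) (hB : B ∈ G) (hC : C ∈ G) : G = ⊤ := by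
  classical
  have hne : ∀ n : ℕ, 0 < n → n < 7 → (n : F) ≠ 0 := by
    intro n h0 h7 h
    exact absurd (Nat.le_of_dvd h0 ((CharP.cast_eq_zero_iff F p n).1 h)) (by omega)
  have h2 : (2 : F) ≠ 0 := by exact_mod_cast hne 2 (by norm_num) (by norm_num)
  have h3 : (3 : F) ≠ 0 := by exact_mod_cast hne 3 (by norm_num) (by norm_num)
  have h5 : (5 : F) ≠ 0 := by exact_mod_cast hne 5 (by norm_num) (by norm_num)
  have hG := T.neg_one_mem hA
  by_cases hpar : ∃ u ∈ G, ¬ (u = 1 ∨ u = -1) ∧ (u 0 0 + u 1 1) ^ 2 = 4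
  · obtain ⟨u, hu, hu1, hut⟩ := hpar
    refine eq_top_of_parabolic_mem (p := p) (by omega) (hF.imp_right fun h => ⟨h.1, A * C,
      G.mul_mem hA hC, by rw [T.trAC]; exact h.2⟩) hG (fun y => ?_) hu hu1 hut
    by_contra! hcon
    exact T.no_fixed_point (hcon A hA) (hcon B hB)
  · exfalso
    let f := algebraMap F (AlgebraicClosure F)
    let φ := Matrix.SpecialLinearGroup.map (n := Fin 2) f
    have hinj : Function.Injective φ := by
      intro g h hgh
      ext i j
      apply f.injective
      have := congrArg (fun k : SL(2, AlgebraicClosure F) => k i j) hgh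
      simpa [φ] using this
    let H := G.map φ
    have hfin : Finite H := Set.Finite.image _ (Set.toFinite (G : Set SL(2, F)))
    have hneg : φ (-1) = -1 := by apply sl_ext <;> simp [φ]
    have hH : -1 ∈ H := ⟨-1, hG, hneg⟩
    have h2' : (2 : AlgebraicClosure F) ≠ 0 := by
      rw [← map_ofNat f 2]; exact (map_ne_zero f).2 h2
    have hcard : Nat.card H = Nat.card G :=
      (Nat.card_congr (G.equivMapOfInjective φ hinj).toEquiv).symm
    rcases icosahedral_of_no_parabolic h2' (H := H) hH (by
      rintro _ ⟨g, hg, rfl⟩ ht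
      have : (g 0 0 + g 1 1) ^ 2 = 4 := f.injective (by
        rw [map_ofNat]; simpa [φ] using ht)
      by_contra hcon
      refine hpar ⟨g, hg, fun h => hcon ?_, this⟩
      rcases h with rfl | rfl
      · left; exact map_one φ
      · right; exact hneg) (hcard ▸ T.sixty_dvd_card h2 h3 h5 hA hB) with ⟨y, hy⟩ | hy
    · have key : ∀ g ∈ G, ∀ n, g ^ (n * 2) = -g → φ g • y = y := by
        intro g hg n hn
        have h := hy _ (Subgroup.mem_map_of_mem φ (G.pow_mem hg n))
        rw [← map_pow, ← pow_mul, hn, ← neg_one_mul, map_mul, hneg, mul_smul,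
          sl_neg_one_smul] at h
        exact h
      refine (T.map f).no_fixed_point (key A hA 2 ?_) (key B hB 3 ?_)
      · rw [show 2 * 2 = 3 + 1 from rfl, pow_succ, T.pow_three, neg_one_mul]
      · rw [show 3 * 2 = 5 + 1 from rfl, pow_succ, T.pow_five, neg_one_mul]
    · refine T.order_ne h2 h3 ?_
      have := hy _ (Subgroup.mem_map_of_mem φ (G.mul_mem hA hC))
      simpa only [← map_pow, map_eq_one_iff φ hinj] using this

end TetTriple
end Triple

section Words
variable {F : Type*} [Field F] {τ x : F} {A B C : SL(2, F)}

/-- The matrices `A`, `B` of a triple generate the full matrix algebra, so that its elements are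
determined by traces. -/
theorem TetTriple.eq_zero_of_trace (T : TetTriple τ x A B C) {M : Matrix (Fin 2) (Fin 2) F}
    (h1 : M.trace = 0) (hA : (M * A.1).trace = 0) (hB : (M * B.1).trace = 0)
    (hAB : (M * A.1 * B.1).trace = 0) : M = 0 := by
  have tA := T.trA
  have tB := T.trB
  have tAB := T.trAB
  have dA := sl_det A
  have dB := sl_det B
  have ht := T.tau
  simp only [sl_mul_apply] at tAB
  simp only [Matrix.trace_fin_two, Matrix.mul_apply, Fin.sum_univ_two] at h1 hA hB hAB
  generalize A.1 0 0 = a at *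
  generalize A.1 0 1 = b at *
  generalize A.1 1 0 = c at *
  generalize A.1 1 1 = d at *
  generalize B.1 0 0 = e at *
  generalize B.1 0 1 = f at *
  generalize B.1 1 0 = g at *
  generalize B.1 1 1 = h at *
  have hD : (a - d) * (f * (c * e + d * g) - g * (a * f + b * h)) -
      b * ((e - h) * (c * e + d * g) - g * (a * e + b * g - c * f - d * h)) +
      c * ((e - h) * (a * f + b * h) - f * (a * e + b * g - c * f - d * h)) = τ - 2 := by
    have key : (a - d) * (f * (c * e + d * g) - g * (a * f + b * h)) -
        b * ((e - h) * (c * e + d * g) - g * (a * e + b * g - c * f - d * h)) +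
        c * ((e - h) * (a * f + b * h) - f * (a * e + b * g - c * f - d * h)) =
        (a + d) ^ 2 * (e * h - f * g) + (e + h) ^ 2 * (a * d - b * c) +
        (a * e + b * g + (c * f + d * h)) ^ 2 -
        (a + d) * (e + h) * (a * e + b * g + (c * f + d * h)) -
        4 * (a * d - b * c) * (e * h - f * g) := by ring
    rw [key, tA, tB, tAB, dA, dB]
    linear_combination ht
  have hne : τ - 2 ≠ 0 := by
    intro h0
    have : τ = 2 := by linear_combination h0
    rw [this] at ht
    exact one_ne_zero (α := F) (by linear_combination ht)
  have h11 : M 1 1 = -M 0 0 := by linear_combination h1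
  rw [h11] at hA hB hAB
  have e00 : (τ - 2) * M 0 0 = 0 := by
    rw [← hD]
    linear_combination (f * (c * e + d * g) - g * (a * f + b * h)) * hA +
      ((a * f + b * h) * c - (c * e + d * g) * b) * hB + (b * g - c * f) * hAB
  have e10 : (τ - 2) * M 1 0 = 0 := by
    rw [← hD]
    linear_combination (g * ((a * e + b * g) - (c * f + d * h)) - (e - h) * (c * e + d * g)) * hA +
      ((c * e + d * g) * (a - d) - ((a * e + b * g) - (c * f + d * h)) * c) * hB + (c * (e - h) - (a - d) * g) * hAB
  have e01 : (τ - 2) * M 0 1 = 0 := by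
    rw [← hD]
    linear_combination ((e - h) * (a * f + b * h) - f * ((a * e + b * g) - (c * f + d * h))) * hA +
      (((a * e + b * g) - (c * f + d * h)) * b - (a * f + b * h) * (a - d)) * hB + ((a - d) * f - b * (e - h)) * hAB
  have z00 := (mul_eq_zero.1 e00).resolve_left hne
  have z01 := (mul_eq_zero.1 e01).resolve_left hne
  have z10 := (mul_eq_zero.1 e10).resolve_left hne
  ext i j
  fin_cases i <;> fin_cases j
  · exact z00
  · exact z01
  · exact z10
  · exact h11.trans (by rw [z00, neg_zero]; rfl)

theorem sl_coe_mul_self (g : SL(2, F)) : g.1 * g.1 = (g 0 0 + g 1 1) • g.1 - 1 := by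
  ext i j
  have := sl_pow_two_apply g i j
  rw [pow_two] at this
  simpa using this

theorem sl_coe_mul_comm (g h : SL(2, F)) : h.1 * g.1 = -(g.1 * h.1) + (g 0 0 + g 1 1) • h.1 +
    (h 0 0 + h 1 1) • g.1 +
    ((g * h) 0 0 + (g * h) 1 1 - (g 0 0 + g 1 1) * (h 0 0 + h 1 1)) • 1 := by
  ext i j
  fin_cases i <;> fin_cases j <;> simp [Matrix.mul_apply, Fin.sum_univ_two] <;> ring

theorem sl_combination_mul_left (g h : SL(2, F)) (c₀ c₁ c₂ c₃ : F) :
    (c₀ • 1 + c₁ • g.1 + c₂ • h.1 + c₃ • (g.1 * h.1)) * g.1 =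
      (-c₁ + c₂ * ((g * h) 0 0 + (g * h) 1 1 - (g 0 0 + g 1 1) * (h 0 0 + h 1 1)) -
          c₃ * (h 0 0 + h 1 1)) • 1 +
        (c₀ + c₁ * (g 0 0 + g 1 1) + c₂ * (h 0 0 + h 1 1) + c₃ * ((g * h) 0 0 + (g * h) 1 1)) • g.1 +
        (c₂ * (g 0 0 + g 1 1) + c₃) • h.1 + (-c₂) • (g.1 * h.1) := by
  have h1 := sl_coe_mul_self g
  have h3 := sl_coe_mul_comm g h
  have h4 : g.1 * h.1 * g.1 = h.1 - (h 0 0 + h 1 1) • 1 + ((g * h) 0 0 + (g * h) 1 1) • g.1 := by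
    rw [mul_assoc, h3]
    simp only [mul_add, mul_neg, mul_smul_comm, mul_one, ← mul_assoc, h1, sub_mul, one_mul,
      smul_mul_assoc]
    module
  simp only [add_mul, smul_mul_assoc, one_mul, h1, h3, h4]
  module

theorem sl_combination_mul_right (g h : SL(2, F)) (c₀ c₁ c₂ c₃ : F) :
    (c₀ • 1 + c₁ • g.1 + c₂ • h.1 + c₃ • (g.1 * h.1)) * h.1 =
      (-c₂) • 1 + (-c₃) • g.1 + (c₀ + c₂ * (h 0 0 + h 1 1)) • h.1 +
        (c₁ + c₃ * (h 0 0 + h 1 1)) • (g.1 * h.1) := by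
  have h2 := sl_coe_mul_self h
  have h4 : g.1 * h.1 * h.1 = (h 0 0 + h 1 1) • (g.1 * h.1) - g.1 := by
    rw [mul_assoc, h2]
    simp only [mul_sub, mul_smul_comm, mul_one]
  simp only [add_mul, smul_mul_assoc, one_mul, h2, h4]
  module

theorem TetTriple.smul_relation (T : TetTriple τ x A B C) :
    C.1 = (τ ^ 2 * (x - τ)) • 1 + (τ ^ 2 * (1 - 2 * x)) • A.1 + τ ^ 3 • B.1 +
      (-(τ ^ 3 * (1 - x))) • (A.1 * B.1) := by
  have tA := T.trA
  have tB := T.trB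
  have tC := T.trC
  have tAB := T.trAB
  have tAC := T.trAC
  have tBC := T.trBC
  have tABC := T.trABC
  have ht := T.tau
  have tr : ∀ c₀ c₁ c₂ c₃ : F,
      (c₀ • 1 + c₁ • A.1 + c₂ • B.1 + c₃ • (A.1 * B.1)).trace = c₀ * 2 + c₁ + c₂ * τ := by
    intro c₀ c₁ c₂ c₃
    have h3 := tAB
    simp only [← Matrix.trace_fin_two, Matrix.SpecialLinearGroup.coe_mul] at h3
    simp [Matrix.trace_add, Matrix.trace_smul, h3, Matrix.trace_fin_two A.1,
      Matrix.trace_fin_two B.1, tA, tB]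
  rw [← sub_eq_zero]
  apply T.eq_zero_of_trace <;>
    simp only [sub_mul, sl_combination_mul_left, sl_combination_mul_right, Matrix.trace_sub, tr,
      tA, tB, tAB]
  · rw [Matrix.trace_fin_two, tC]
    grind
  · have h : (C.1 * A.1).trace = x := by
      rw [Matrix.trace_mul_comm, ← tAC, Matrix.trace_fin_two]; rfl
    rw [h]
    grind
  · have h : (C.1 * B.1).trace = 0 := by
      rw [Matrix.trace_mul_comm, ← tBC, Matrix.trace_fin_two]; rfl
    rw [h]
    grind
  · have h : (C.1 * A.1 * B.1).trace = 0 := by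
      rw [mul_assoc, Matrix.trace_mul_comm, ← tABC, Matrix.trace_fin_two]; rfl
    rw [h]
    grind

theorem sl_coe_inv (g : SL(2, F)) : (g⁻¹).1 = g.1.trace • 1 + (-1 : F) • g.1 := by
  obtain ⟨h1, h2, h3, h4⟩ := sl_inv_apply g
  ext i j
  fin_cases i <;> fin_cases j
  · exact h1.trans (by simp [Matrix.trace_fin_two])
  · exact h2.trans (by simp)
  · exact h3.trans (by simp)
  · exact h4.trans (by simp [Matrix.trace_fin_two])

/-- Two pairs of elements whose traces correspond under `σ`. -/
structure SameTraces {F' : Type*} [Field F'] (σ : F →+* F') (A B : SL(2, F)) (A' B' : SL(2, F')) :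
    Prop where
  left : A' 0 0 + A' 1 1 = σ (A 0 0 + A 1 1)
  right : B' 0 0 + B' 1 1 = σ (B 0 0 + B 1 1)
  mul : (A' * B') 0 0 + (A' * B') 1 1 = σ ((A * B) 0 0 + (A * B) 1 1)

/-- Pairs of matrices having the same coordinates, up to `σ`, with respect to `1, A, B, AB` and
`1, A', B', A'B'`. -/
def SameCoords {F' : Type*} [Field F'] (σ : F →+* F') (A B : SL(2, F)) (A' B' : SL(2, F'))
    (M : Matrix (Fin 2) (Fin 2) F) (M' : Matrix (Fin 2) (Fin 2) F') : Prop :=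
  ∃ c₀ c₁ c₂ c₃ : F, M = c₀ • 1 + c₁ • A.1 + c₂ • B.1 + c₃ • (A.1 * B.1) ∧
    M' = σ c₀ • 1 + σ c₁ • A'.1 + σ c₂ • B'.1 + σ c₃ • (A'.1 * B'.1)

namespace SameCoords
variable {F' : Type*} [Field F'] {σ : F →+* F'} {A' B' C' : SL(2, F')}
  {M N : Matrix (Fin 2) (Fin 2) F} {M' N' : Matrix (Fin 2) (Fin 2) F'}

theorem add (h : SameCoords σ A B A' B' M M') (h' : SameCoords σ A B A' B' N N') :
    SameCoords σ A B A' B' (M + N) (M' + N') := by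
  obtain ⟨c₀, c₁, c₂, c₃, rfl, rfl⟩ := h
  obtain ⟨d₀, d₁, d₂, d₃, rfl, rfl⟩ := h'
  refine ⟨c₀ + d₀, c₁ + d₁, c₂ + d₂, c₃ + d₃, ?_, ?_⟩
  · module
  · simp only [map_add]; module

theorem smul (h : SameCoords σ A B A' B' M M') (s : F) :
    SameCoords σ A B A' B' (s • M) (σ s • M') := by
  obtain ⟨c₀, c₁, c₂, c₃, rfl, rfl⟩ := h
  refine ⟨s * c₀, s * c₁, s * c₂, s * c₃, ?_, ?_⟩
  · module
  · simp only [map_mul]; module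

theorem one : SameCoords σ A B A' B' 1 1 := ⟨1, 0, 0, 0, by simp, by simp⟩

theorem left : SameCoords σ A B A' B' A.1 A'.1 := ⟨0, 1, 0, 0, by simp, by simp⟩

theorem right : SameCoords σ A B A' B' B.1 B'.1 := ⟨0, 0, 1, 0, by simp, by simp⟩

theorem mul_left (H : SameTraces σ A B A' B') (h : SameCoords σ A B A' B' M M') :
    SameCoords σ A B A' B' (M * A.1) (M' * A'.1) := by
  obtain ⟨c₀, c₁, c₂, c₃, rfl, rfl⟩ := h
  refine ⟨_, _, _, _, sl_combination_mul_left .., ?_⟩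
  rw [sl_combination_mul_left, H.left, H.right, H.mul]
  simp only [map_add, map_sub, map_mul, map_neg]

theorem mul_right (H : SameTraces σ A B A' B') (h : SameCoords σ A B A' B' M M') :
    SameCoords σ A B A' B' (M * B.1) (M' * B'.1) := by
  obtain ⟨c₀, c₁, c₂, c₃, rfl, rfl⟩ := h
  refine ⟨_, _, _, _, sl_combination_mul_right .., ?_⟩
  rw [sl_combination_mul_right, H.right]
  simp only [map_add, map_mul, map_neg]

theorem mul (H : SameTraces σ A B A' B') (h : SameCoords σ A B A' B' M M')
    (h' : SameCoords σ A B A' B' N N') : SameCoords σ A B A' B' (M * N) (M' * N') := by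
  obtain ⟨d₀, d₁, d₂, d₃, rfl, rfl⟩ := h'
  simp only [mul_add, mul_smul_comm, mul_one, ← mul_assoc]
  exact (((h.smul _).add ((h.mul_left H).smul _)).add ((h.mul_right H).smul _)).add
    (((h.mul_left H).mul_right H).smul _)

theorem trace_eq (H : SameTraces σ A B A' B') (h : SameCoords σ A B A' B' M M') :
    M'.trace = σ M.trace := by
  obtain ⟨c₀, c₁, c₂, c₃, rfl, rfl⟩ := h
  have h1 := H.left
  have h2 := H.right
  have h3 := H.mul
  simp only [← Matrix.trace_fin_two, Matrix.SpecialLinearGroup.coe_mul] at h1 h2 h3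
  simp only [Matrix.trace_add, Matrix.trace_smul, h1, h2, h3, Matrix.trace_one, Fintype.card_fin,
    smul_eq_mul, map_add, map_mul, map_natCast]

theorem inv (H : SameTraces σ A B A' B') {g : SL(2, F)} {g' : SL(2, F')}
    (h : SameCoords σ A B A' B' g.1 g'.1) : SameCoords σ A B A' B' (g⁻¹).1 (g'⁻¹).1 := by
  rw [sl_coe_inv g, sl_coe_inv g', h.trace_eq H]
  have h1 := h.smul (-1)
  rw [map_neg, map_one] at h1
  exact (one.smul _).add h1

/-- Coordinates in two corresponding pairs agree on the subgroup generated by the pairs. -/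
theorem of_mem_closure (H : SameTraces σ A B A' B') {S : Set (SL(2, F) × SL(2, F'))}
    (hS : ∀ g ∈ S, SameCoords σ A B A' B' g.1.1 g.2.1) {g : SL(2, F) × SL(2, F')}
    (hg : g ∈ Subgroup.closure S) : SameCoords σ A B A' B' g.1.1 g.2.1 := by
  induction hg using Subgroup.closure_induction with
  | mem g hg => exact hS g hg
  | one => exact one
  | mul g k _ _ hg hk => exact hg.mul H hk
  | inv g _ hg => exact hg.inv H

end SameCoords

namespace TetTriple
variable {F' : Type*} [Field F'] {σ : F →+* F'} {A' B' C' : SL(2, F')}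

theorem sameTraces (T : TetTriple τ x A B C) (T' : TetTriple (σ τ) (σ x) A' B' C') :
    SameTraces σ A B A' B' :=
  ⟨by rw [T.trA, T'.trA, map_one], by rw [T.trB, T'.trB], by rw [T.trAB, T'.trAB, map_zero]⟩

theorem sameCoords (T : TetTriple τ x A B C) (T' : TetTriple (σ τ) (σ x) A' B' C')
    {g : SL(2, F) × SL(2, F')}
    (hg : g ∈ Subgroup.closure {(A, A'), (B, B'), (C, C')}) :
    SameCoords σ A B A' B' g.1.1 g.2.1 := by
  refine SameCoords.of_mem_closure (T.sameTraces T') ?_ hg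
  rintro _ (rfl | rfl | rfl)
  · exact SameCoords.left
  · exact SameCoords.right
  · refine ⟨_, _, _, _, T.smul_relation, ?_⟩
    rw [T'.smul_relation]
    simp only [map_sub, map_mul, map_neg, map_pow, map_one, map_ofNat]

theorem eq_zero_iff (T : TetTriple τ x A B C) (T' : TetTriple (σ τ) (σ x) A' B' C')
    {M : Matrix (Fin 2) (Fin 2) F} {M' : Matrix (Fin 2) (Fin 2) F'}
    (h : SameCoords σ A B A' B' M M') : M = 0 ↔ M' = 0 := by
  have H := T.sameTraces T'
  have t1 := h.trace_eq H
  have t2 := (h.mul_left H).trace_eq H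
  have t3 := (h.mul_right H).trace_eq H
  have t4 := ((h.mul_left H).mul_right H).trace_eq H
  constructor
  · rintro rfl
    apply T'.eq_zero_of_trace <;> simp [t1, t2, t3, t4]
  · rintro rfl
    apply T.eq_zero_of_trace <;> apply σ.injective <;> rw [map_zero]
    · simp [← t1]
    · simp [← t2]
    · simp [← t3]
    · simp [← t4]

theorem eq_one_or_neg_one_iff (T : TetTriple τ x A B C) (T' : TetTriple (σ τ) (σ x) A' B' C')
    {g : SL(2, F) × SL(2, F')}
    (hg : g ∈ Subgroup.closure {(A, A'), (B, B'), (C, C')}) :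
    (g.1 = 1 ∨ g.1 = -1) ↔ (g.2 = 1 ∨ g.2 = -1) := by
  have h := T.sameCoords T' hg
  have h1 := T.eq_zero_iff T' (h.add ((SameCoords.one (σ := σ)).smul (-1)))
  have h2 := T.eq_zero_iff T' (h.add SameCoords.one)
  rw [map_neg, map_one, neg_one_smul, neg_one_smul, ← sub_eq_add_neg, ← sub_eq_add_neg,
    sub_eq_zero, sub_eq_zero] at h1
  rw [add_eq_zero_iff_eq_neg, add_eq_zero_iff_eq_neg] at h2
  have key : (g.1 = 1 ∨ g.1 = -1) ↔ (g.1.1 = 1 ∨ g.1.1 = -1) :=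
    or_congr Subtype.ext_iff Subtype.ext_iff
  have e : (g.2 = 1 ∨ g.2 = -1) ↔ (g.2.1 = 1 ∨ g.2.1 = -1) :=
    or_congr Subtype.ext_iff Subtype.ext_iff
  rw [key, e]
  exact or_congr h1 h2

end TetTriple
end Words

section Quotients
variable {F : Type*} [Field F] {τ x : F} {A B C : SL(2, F)}

/-- The projection `SL(2, F) → PSL(2, F)`. -/
def pslMk (F : Type*) [Field F] : SL(2, F) →* Matrix.ProjectiveSpecialLinearGroup (Fin 2) F :=
  QuotientGroup.mk' _

theorem pslMk_surjective : Function.Surjective (pslMk F) := QuotientGroup.mk'_surjective _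

theorem pslMk_eq_one {g : SL(2, F)} : pslMk F g = 1 ↔ g = 1 ∨ g = -1 :=
  (QuotientGroup.eq_one_iff g).trans sl_mem_center_iff

theorem pslMk_neg_one : pslMk F (-1) = 1 := pslMk_eq_one.2 (Or.inr rfl)

theorem pslMk_neg (g : SL(2, F)) : pslMk F (-g) = pslMk F g := by
  rw [← neg_one_mul, map_mul, pslMk_neg_one, one_mul]

theorem pslMk_eq_iff {g h : SL(2, F)} : pslMk F g = pslMk F h ↔ g = h ∨ g = -h := by
  rw [← mul_inv_eq_one, ← map_inv, ← map_mul, pslMk_eq_one, mul_inv_eq_one, mul_inv_eq_iff_eq_mul,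
    neg_one_mul]

/-- `f` sends the generators of `Δ` to the classes of `A`, `B`, `C`. -/
structure TetLift (f : Tet →* Matrix.ProjectiveSpecialLinearGroup (Fin 2) F) (A B C : SL(2, F)) :
    Prop where
  map_zero : f (PresentedGroup.of 0) = pslMk F A
  map_one : f (PresentedGroup.of 1) = pslMk F B
  map_two : f (PresentedGroup.of 2) = pslMk F C

theorem tet_relations {G : Type*} [Group G] (f : Tet →* G) :
    f (.of 0) ^ 3 = 1 ∧ f (.of 1) ^ 5 = 1 ∧ f (.of 2) ^ 3 = 1 ∧ (f (.of 0) * f (.of 1)) ^ 2 = 1 ∧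
      (f (.of 1) * f (.of 2)) ^ 2 = 1 ∧ (f (.of 0) * f (.of 1) * f (.of 2)) ^ 2 = 1 := by
  have key : ∀ r ∈ tetRelators, f (PresentedGroup.mk tetRelators r) = 1 := by
    intro r hr
    rw [PresentedGroup.one_of_mem hr, _root_.map_one]
  refine ⟨?_, ?_, ?_, ?_, ?_, ?_⟩ <;> simp only [← map_pow, ← map_mul] <;> apply key <;>
    simp [tetRelators]

theorem tet_induction {P : Tet → Prop} (h0 : P (.of 0)) (h1 : P (.of 1)) (h2 : P (.of 2))
    (one : P 1) (mul : ∀ v w, P v → P w → P (v * w)) (inv : ∀ v, P v → P v⁻¹) (w : Tet) : P w := by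
  have hw : w ∈ Subgroup.closure (Set.range (PresentedGroup.of (rels := tetRelators))) := by
    rw [PresentedGroup.closure_range_of]
    trivial
  induction hw using Subgroup.closure_induction with
  | mem g hg =>
    obtain ⟨i, rfl⟩ := hg
    fin_cases i
    · exact h0
    · exact h1
    · exact h2
  | one => exact one
  | mul g k _ _ hg hk => exact mul g k hg hk
  | inv g _ hg => exact inv g hg

theorem TetTriple.exists_lift (T : TetTriple τ x A B C) :
    ∃ f : Tet →* Matrix.ProjectiveSpecialLinearGroup (Fin 2) F, TetLift f A B C := by
  have key : ∀ {g : SL(2, F)}, g 0 0 + g 1 1 = 0 → g ^ 2 = -1 := by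
    intro g hg
    have h := sl_pow_two_apply g
    rw [hg] at h
    apply sl_ext <;> rw [h] <;> simp
  have key' : ∀ {g : SL(2, F)}, g 0 0 + g 1 1 = 1 → g ^ 3 = -1 := by
    intro g hg
    have h := sl_pow_three_apply g
    rw [hg] at h
    apply sl_ext <;> rw [h] <;> simp
  have h : ∀ r ∈ tetRelators, FreeGroup.lift (fun i => pslMk F (![A, B, C] i)) r = 1 := by
    rintro r (rfl | rfl | rfl | rfl | rfl | rfl)
    all_goals
      simp only [map_pow, map_mul, FreeGroup.lift_apply_of]
      simp only [← map_pow, ← map_mul]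
      apply pslMk_eq_one.2
      right
    · exact key' T.trA
    · exact T.pow_five
    · exact key' T.trC
    · exact key T.trAB
    · exact key T.trBC
    · exact key T.trABC
  refine ⟨PresentedGroup.toGroup h, ?_, ?_, ?_⟩ <;> rw [PresentedGroup.toGroup.of] <;> rfl

theorem TetLift.exists_mem_closure {F' : Type*} [Field F'] {A' B' C' : SL(2, F')}
    {f : Tet →* Matrix.ProjectiveSpecialLinearGroup (Fin 2) F} (hf : TetLift f A B C)
    {f' : Tet →* Matrix.ProjectiveSpecialLinearGroup (Fin 2) F'} (hf' : TetLift f' A' B' C')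
    (w : Tet) : ∃ g ∈ Subgroup.closure {(A, A'), (B, B'), (C, C')},
      f w = pslMk F g.1 ∧ f' w = pslMk F' g.2 := by
  induction w using tet_induction with
  | h0 => exact ⟨(A, A'), Subgroup.subset_closure (by simp), hf.map_zero, hf'.map_zero⟩
  | h1 => exact ⟨(B, B'), Subgroup.subset_closure (by simp), hf.map_one, hf'.map_one⟩
  | h2 => exact ⟨(C, C'), Subgroup.subset_closure (by simp), hf.map_two, hf'.map_two⟩
  | one => exact ⟨1, one_mem _, by simp, by simp⟩
  | mul v w hv hw =>
    obtain ⟨g, hg, h1, h2⟩ := hv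
    obtain ⟨k, hk, h3, h4⟩ := hw
    exact ⟨g * k, mul_mem hg hk, by simp [h1, h3], by simp [h2, h4]⟩
  | inv v hv =>
    obtain ⟨g, hg, h1, h2⟩ := hv
    exact ⟨g⁻¹, inv_mem hg, by simp [h1], by simp [h2]⟩

theorem TetTriple.ker_eq {F' : Type*} [Field F'] {σ : F →+* F'} {A' B' C' : SL(2, F')}
    (T : TetTriple τ x A B C) (T' : TetTriple (σ τ) (σ x) A' B' C')
    {f : Tet →* Matrix.ProjectiveSpecialLinearGroup (Fin 2) F} (hf : TetLift f A B C)
    {f' : Tet →* Matrix.ProjectiveSpecialLinearGroup (Fin 2) F'} (hf' : TetLift f' A' B' C') :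
    f.ker = f'.ker := by
  ext w
  obtain ⟨g, hg, h1, h2⟩ := hf.exists_mem_closure hf' w
  rw [MonoidHom.mem_ker, MonoidHom.mem_ker, h1, h2, pslMk_eq_one, pslMk_eq_one]
  exact T.eq_one_or_neg_one_iff T' hg

theorem TetLift.surjective {f : Tet →* Matrix.ProjectiveSpecialLinearGroup (Fin 2) F}
    (hf : TetLift f A B C)
    (h : ∀ G : Subgroup SL(2, F), A ∈ G → B ∈ G → C ∈ G → G = ⊤) : Function.Surjective f := by
  have := h (f.range.comap (pslMk F)) ⟨_, hf.map_zero⟩ ⟨_, hf.map_one⟩ ⟨_, hf.map_two⟩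
  intro k
  obtain ⟨g, rfl⟩ := pslMk_surjective k
  have hg : g ∈ f.range.comap (pslMk F) := this ▸ Subgroup.mem_top g
  exact hg

theorem exists_tetLift (f : Tet →* Matrix.ProjectiveSpecialLinearGroup (Fin 2) F) :
    ∃ A B C : SL(2, F), TetLift f A B C := by
  obtain ⟨A, hA⟩ := pslMk_surjective (f (.of 0))
  obtain ⟨B, hB⟩ := pslMk_surjective (f (.of 1))
  obtain ⟨C, hC⟩ := pslMk_surjective (f (.of 2))
  exact ⟨A, B, C, hA.symm, hB.symm, hC.symm⟩

theorem sl_exists_sign {g : SL(2, F)} {P : F → Prop}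
    (h : P (g 0 0 + g 1 1) ∨ P (-(g 0 0 + g 1 1))) :
    ∃ k : SL(2, F), pslMk F k = pslMk F g ∧ P (k 0 0 + k 1 1) := by
  rcases h with h | h
  · exact ⟨g, rfl, h⟩
  · refine ⟨-g, pslMk_neg g, ?_⟩
    have e : (-g) 0 0 + (-g) 1 1 = -(g 0 0 + g 1 1) := by
      rw [Matrix.SpecialLinearGroup.coe_neg, Matrix.neg_apply, Matrix.neg_apply]
      ring
    rwa [e]

theorem eq_one_of_pow_coprime {G : Type*} [Group G] {g : G} {m n : ℕ} (hm : g ^ m = 1)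
    (hn : g ^ n = 1) (h : Nat.Coprime m n) : g = 1 := by
  have := Nat.dvd_gcd (orderOf_dvd_of_pow_eq_one hm) (orderOf_dvd_of_pow_eq_one hn)
  rw [Nat.Coprime.gcd_eq_one h, Nat.dvd_one] at this
  exact orderOf_eq_one_iff.1 this

/-- In a nontrivial image of `Δ` none of `α, β, γ, αβ, βγ, αβγ` becomes trivial. -/
theorem tet_ne_one {G : Type*} [Group G] (f : Tet →* G) (hf : f ≠ 1) :
    f (.of 0) ≠ 1 ∧ f (.of 1) ≠ 1 ∧ f (.of 2) ≠ 1 ∧ f (.of 0) * f (.of 1) ≠ 1 ∧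
      f (.of 1) * f (.of 2) ≠ 1 ∧ f (.of 0) * f (.of 1) * f (.of 2) ≠ 1 := by
  obtain ⟨ha, hb, hc, hab, hbc, habc⟩ := tet_relations f
  have key : ∀ h : f (.of 0) = 1 ∧ f (.of 1) = 1 ∧ f (.of 2) = 1, False := by
    rintro ⟨h0, h1, h2⟩
    apply hf
    refine MonoidHom.ext fun w => ?_
    induction w using tet_induction with
    | h0 => exact h0
    | h1 => exact h1
    | h2 => exact h2
    | one => simp
    | mul v w hv hw => rw [map_mul, hv, hw]; simp
    | inv v hv => rw [map_inv, hv]; simp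
  generalize f (.of 0) = a at *
  generalize f (.of 1) = b at *
  generalize f (.of 2) = c at *
  have kb : b ≠ 1 := by
    rintro rfl
    rw [mul_one] at hab
    rw [one_mul] at hbc
    exact key ⟨eq_one_of_pow_coprime ha hab (by norm_num), rfl,
      eq_one_of_pow_coprime hc hbc (by norm_num)⟩
  refine ⟨?_, kb, ?_, ?_, ?_, ?_⟩
  · rintro rfl
    rw [one_mul] at hab
    exact kb (eq_one_of_pow_coprime hb hab (by norm_num))
  · rintro rfl
    rw [mul_one] at hbc
    exact kb (eq_one_of_pow_coprime hb hbc (by norm_num))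
  · intro h
    rw [← inv_eq_iff_mul_eq_one] at h
    rw [← h, inv_pow, inv_eq_one] at hb
    apply kb
    rw [← h, inv_eq_one]
    exact eq_one_of_pow_coprime ha hb (by norm_num)
  · intro h
    rw [← inv_eq_iff_mul_eq_one] at h
    rw [← h, inv_pow, inv_eq_one] at hc
    exact kb (eq_one_of_pow_coprime hb hc (by norm_num))
  · intro h
    rw [← inv_eq_iff_mul_eq_one] at h
    rw [← inv_eq_one, ← inv_pow, h] at hab
    have hc1 : c = 1 := eq_one_of_pow_coprime hc hab (by norm_num)
    rw [hc1, mul_one] at hbc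
    exact kb (eq_one_of_pow_coprime hb hbc (by norm_num))

theorem trace_eq_zero_of_pslMk_sq {g : SL(2, F)} (h1 : pslMk F g ≠ 1) (h : pslMk F g ^ 2 = 1) :
    g 0 0 + g 1 1 = 0 := by
  rw [← map_pow] at h
  exact sl_eq_zero_of_scalar (mt pslMk_eq_one.2 h1)
    (fun i j => by rw [sl_pow_two_apply, one_mul]) (pslMk_eq_one.1 h) (v := 1)

theorem exists_trace_eq_one {g : SL(2, F)} (h1 : pslMk F g ≠ 1) (h : pslMk F g ^ 3 = 1) :
    ∃ k : SL(2, F), pslMk F k = pslMk F g ∧ k 0 0 + k 1 1 = 1 := by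
  rw [← map_pow] at h
  have := sl_eq_zero_of_scalar (mt pslMk_eq_one.2 h1) (sl_pow_three_apply g) (pslMk_eq_one.1 h)
  apply sl_exists_sign (P := fun t => t = 1)
  rw [sub_eq_zero, sq_eq_one_iff] at this
  exact this.imp_right fun h => by rw [h, neg_neg]

theorem exists_trace_sq_eq {g : SL(2, F)} (h1 : pslMk F g ≠ 1) (h : pslMk F g ^ 5 = 1) :
    ∃ k : SL(2, F), pslMk F k = pslMk F g ∧ (k 0 0 + k 1 1) ^ 2 = k 0 0 + k 1 1 + 1 := by
  rw [← map_pow] at h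
  have := sl_eq_zero_of_scalar (mt pslMk_eq_one.2 h1) (sl_pow_five_apply g) (pslMk_eq_one.1 h)
  apply sl_exists_sign (P := fun t => t ^ 2 = t + 1)
  generalize g 0 0 + g 1 1 = t at *
  have h2 : (t ^ 2 - (t + 1)) * ((-t) ^ 2 - (-t + 1)) = 0 := by linear_combination this
  exact (mul_eq_zero.1 h2).imp sub_eq_zero.1 sub_eq_zero.1

/-- Every nontrivial homomorphism `Δ → PSL(2, F)` comes from a `TetTriple`. -/
theorem exists_tetTriple (f : Tet →* Matrix.ProjectiveSpecialLinearGroup (Fin 2) F) (hf : f ≠ 1) :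
    ∃ (τ x : F) (A B C : SL(2, F)), TetTriple τ x A B C ∧ TetLift f A B C := by
  obtain ⟨ha, hb, hc, hab, hbc, habc⟩ := tet_relations f
  obtain ⟨na, nb, nc, nab, nbc, nabc⟩ := tet_ne_one f hf
  obtain ⟨A₀, B₀, C₀, h0, h1, h2⟩ := exists_tetLift f
  rw [h0] at ha na
  rw [h1] at hb nb
  rw [h2] at hc nc
  obtain ⟨A, hA, tA⟩ := exists_trace_eq_one na ha
  obtain ⟨B, hB, tB⟩ := exists_trace_sq_eq nb hb
  obtain ⟨C, hC, tC⟩ := exists_trace_eq_one nc hc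
  rw [← hA] at h0
  rw [← hB] at h1
  rw [← hC] at h2
  rw [h0, h1, ← map_mul] at hab nab
  rw [h1, h2, ← map_mul] at hbc nbc
  rw [h0, h1, h2, ← map_mul, ← map_mul] at habc nabc
  exact ⟨_, _, A, B, C, ⟨tB, tA, rfl, tC, trace_eq_zero_of_pslMk_sq nab hab,
    trace_eq_zero_of_pslMk_sq nbc hbc, trace_eq_zero_of_pslMk_sq nabc habc, rfl⟩, h0, h1, h2⟩

theorem ne_one_of_surjective {f : Tet →* Matrix.ProjectiveSpecialLinearGroup (Fin 2) F}
    (hf : Function.Surjective f) : f ≠ 1 := by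
  rintro rfl
  obtain ⟨w, hw⟩ := hf (pslMk F (upperShear 1))
  have h := pslMk_eq_one.1 (hw.symm.trans (MonoidHom.one_apply w))
  rw [sl_eq_one_or_neg_one_iff] at h
  have := h.1
  simp [upperShear] at this

end Quotients

section Existence
variable {F : Type*} [Field F] {τ x : F}

theorem det_sl_combination (g h : SL(2, F)) (c₀ c₁ c₂ c₃ : F) :
    (c₀ • 1 + c₁ • g.1 + c₂ • h.1 + c₃ • (g.1 * h.1)).det =
      c₀ ^ 2 + c₁ ^ 2 + c₂ ^ 2 + c₃ ^ 2 + c₀ * c₁ * (g 0 0 + g 1 1) + c₀ * c₂ * (h 0 0 + h 1 1) +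
        c₀ * c₃ * ((g * h) 0 0 + (g * h) 1 1) +
        c₁ * c₂ * ((g 0 0 + g 1 1) * (h 0 0 + h 1 1) - ((g * h) 0 0 + (g * h) 1 1)) +
        c₁ * c₃ * (h 0 0 + h 1 1) + c₂ * c₃ * (g 0 0 + g 1 1) := by
  have hg := sl_det g
  have hh := sl_det h
  simp only [sl_mul_apply]
  rw [Matrix.det_fin_two]
  simp only [Matrix.add_apply, Matrix.smul_apply, smul_eq_mul, Matrix.one_apply_eq, ne_eq,
    zero_ne_one, one_ne_zero, not_false_eq_true, Matrix.one_apply_ne, Matrix.mul_apply,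
    Fin.sum_univ_two]
  generalize g.1 0 0 = a at *
  generalize g.1 0 1 = b at *
  generalize g.1 1 0 = c at *
  generalize g.1 1 1 = d at *
  generalize h.1 0 0 = e at *
  generalize h.1 0 1 = f at *
  generalize h.1 1 0 = k at *
  generalize h.1 1 1 = l at *
  linear_combination (c₁ ^ 2 + c₁ * c₃ * (e + l) + c₃ ^ 2 * (e * l - f * k)) * hg +
    (c₂ ^ 2 + c₂ * c₃ * (a + d) + c₃ ^ 2) * hh

theorem exists_third {A B : SL(2, F)} (ht : τ ^ 2 = τ + 1) (hx : x ^ 2 - x + τ - 1 = 0)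
    (tA : A 0 0 + A 1 1 = 1) (tB : B 0 0 + B 1 1 = τ) (tAB : (A * B) 0 0 + (A * B) 1 1 = 0) :
    ∃ C, TetTriple τ x A B C := by
  let M := (τ ^ 2 * (x - τ)) • 1 + (τ ^ 2 * (1 - 2 * x)) • A.1 + τ ^ 3 • B.1 +
      (-(τ ^ 3 * (1 - x))) • (A.1 * B.1)
  have hM : M.det = 1 := by
    rw [det_sl_combination, tA, tB, tAB]
    grind
  have tr : ∀ c₀ c₁ c₂ c₃ : F,
      (c₀ • 1 + c₁ • A.1 + c₂ • B.1 + c₃ • (A.1 * B.1)).trace = c₀ * 2 + c₁ + c₂ * τ := by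
    intro c₀ c₁ c₂ c₃
    have h3 := tAB
    simp only [← Matrix.trace_fin_two, Matrix.SpecialLinearGroup.coe_mul] at h3
    simp [Matrix.trace_add, Matrix.trace_smul, h3, Matrix.trace_fin_two A.1,
      Matrix.trace_fin_two B.1, tA, tB]
  refine ⟨⟨M, hM⟩, ht, tA, tB, ?_, tAB, ?_, ?_, ?_⟩
  · refine (Matrix.trace_fin_two M).symm.trans ?_
    rw [tr]
    grind
  · refine (Matrix.trace_fin_two (B.1 * M)).symm.trans ?_
    rw [Matrix.trace_mul_comm, sl_combination_mul_right, tr, tB]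
    grind
  · refine (Matrix.trace_fin_two (A.1 * B.1 * M)).symm.trans ?_
    rw [Matrix.trace_mul_comm, ← mul_assoc, sl_combination_mul_left, sl_combination_mul_right, tr,
      tA, tB, tAB]
    grind
  · refine (Matrix.trace_fin_two (A.1 * M)).symm.trans ?_
    rw [Matrix.trace_mul_comm, sl_combination_mul_left, tr, tA, tB, tAB]
    grind

theorem exists_tetTriple_of_root [Finite F] (h2 : (2 : F) ≠ 0) (h3 : (3 : F) ≠ 0)
    (ht : τ ^ 2 = τ + 1) (hx : x ^ 2 - x + τ - 1 = 0) : ∃ A B C, TetTriple τ x A B C := by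
  have := Fintype.ofFinite F
  obtain ⟨k, s, hks⟩ : ∃ k s : F, k ^ 2 + (3 / 4 * s ^ 2 - τ * s + 1) = 0 := by
    have h34 : (3 / 4 : F) ≠ 0 := by
      rw [show (4 : F) = 2 * 2 by norm_num]
      exact div_ne_zero h3 (mul_ne_zero h2 h2)
    have hf : (Polynomial.X ^ 2 : Polynomial F).degree = 2 := Polynomial.degree_X_pow 2
    have hg := Polynomial.degree_quadratic (b := -τ) (c := 1) h34
    obtain ⟨a, b, h⟩ := FiniteField.exists_root_sum_quadratic hf hg (by
      refine FiniteField.odd_card_of_char_ne_two fun h => h2 ?_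
      have := ringChar.Nat.cast_ringChar (R := F)
      rwa [h] at this)
    refine ⟨a, b, ?_⟩
    simp at h
    linear_combination h
  let A : SL(2, F) := ⟨!![0, -1; 1, 1], by simp⟩
  let B : SL(2, F) := ⟨!![τ - s, k - s / 2; k + s / 2, s], by
    rw [Matrix.det_fin_two_of]
    have h4 : (4 : F) ≠ 0 := by
      rw [show (4 : F) = 2 * 2 by norm_num]
      exact mul_ne_zero h2 h2
    field_simp
    field_simp at hks
    linear_combination -hks⟩
  obtain ⟨C, hC⟩ := exists_third (A := A) (B := B) ht hx (zero_add 1) (by simp [B]) (by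
    rw [sl_mul_apply, sl_mul_apply]
    simp [A, B]
    field_simp
    ring)
  exact ⟨A, B, C, hC⟩

end Existence

section Arithmetic
variable {p : ℕ} [Fact p.Prime]

theorem isSquare_five (h5 : p % 5 = 1 ∨ p % 5 = 4) : IsSquare (5 : ZMod p) := by
  have h2 : p ≠ 2 := by rintro rfl; omega
  have hp : IsSquare (p : ZMod 5) := by
    rw [← ZMod.natCast_mod]
    rcases h5 with h | h <;> rw [h]
    · exact ⟨1, by decide⟩
    · exact ⟨2, by decide⟩
  have : Fact (Nat.Prime 5) := ⟨by norm_num⟩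
  have := (ZMod.exists_sq_eq_prime_iff_of_mod_four_eq_one (p := 5) (q := p) (by norm_num) h2).1 hp
  exact_mod_cast this

theorem not_isSquare_neg_eleven
    (h11 : p % 11 = 2 ∨ p % 11 = 6 ∨ p % 11 = 7 ∨ p % 11 = 8 ∨ p % 11 = 10) (h2 : p ≠ 2) :
    ¬ IsSquare (-11 : ZMod p) := by
  have hp : ¬ IsSquare (p : ZMod 11) := by
    rw [← ZMod.natCast_mod]
    rcases h11 with h | h | h | h | h <;> rw [h] <;> decide
  have : Fact (Nat.Prime 11) := ⟨by norm_num⟩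
  have hne : p ≠ 11 := by rintro rfl; omega
  have h0 : (11 : ZMod p) ≠ 0 := by
    have h : ((11 : ℕ) : ZMod p) ≠ 0 := by
      rw [ne_eq, ZMod.natCast_eq_zero_iff, Nat.prime_dvd_prime_iff_eq Fact.out Fact.out]
      exact hne
    exact_mod_cast h
  have hodd := (Fact.out : p.Prime).eq_two_or_odd.resolve_left h2
  intro h
  rcases (by omega : p % 4 = 1 ∨ p % 4 = 3) with h4 | h4
  · have hm1 : IsSquare (-1 : ZMod p) := ZMod.exists_sq_eq_neg_one_iff.2 (by omega)
    have h11 := hm1.mul h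
    rw [neg_one_mul, neg_neg] at h11
    exact hp ((ZMod.exists_sq_eq_prime_iff_of_mod_four_eq_one (p := p) (q := 11) h4 (by norm_num)).1
      (by exact_mod_cast h11))
  · have h11 := (ZMod.exists_sq_eq_prime_iff_of_mod_four_eq_three (p := p) (q := 11) h4
      (by norm_num) hne).2 hp
    have hm1 := h.div h11
    rw [Nat.cast_ofNat, neg_div, div_self h0] at hm1
    exact ZMod.exists_sq_eq_neg_one_iff.1 hm1 h4

theorem exists_golden_root (h5 : p % 5 = 1 ∨ p % 5 = 4)
    (h11 : p % 11 = 2 ∨ p % 11 = 6 ∨ p % 11 = 7 ∨ p % 11 = 8 ∨ p % 11 = 10) :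
    ∃ τ : ZMod p, τ ^ 2 = τ + 1 ∧ 5 - 4 * τ ≠ 0 ∧ IsSquare (5 - 4 * τ) ∧
      ¬ IsSquare (5 - 4 * (1 - τ)) := by
  have hp2 : p ≠ 2 := by rintro rfl; omega
  have h2 : (2 : ZMod p) ≠ 0 := by
    have h : ((2 : ℕ) : ZMod p) ≠ 0 := by
      rw [ne_eq, ZMod.natCast_eq_zero_iff, Nat.prime_dvd_prime_iff_eq Fact.out Nat.prime_two]
      exact hp2
    exact_mod_cast h
  obtain ⟨s, hs⟩ := isSquare_five h5
  have key : ∀ τ : ZMod p, τ ^ 2 = τ + 1 →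
      quadraticChar (ZMod p) (5 - 4 * τ) * quadraticChar (ZMod p) (5 - 4 * (1 - τ)) = -1 := by
    intro τ ht
    rw [← map_mul, show (5 - 4 * τ) * (5 - 4 * (1 - τ)) = -11 by linear_combination -16 * ht,
      quadraticChar_neg_one_iff_not_isSquare]
    exact not_isSquare_neg_eleven h11 hp2
  have key' : ∀ τ : ZMod p, τ ^ 2 = τ + 1 → 5 - 4 * τ ≠ 0 := by
    intro τ ht h0
    have := key τ ht
    simp [h0] at this
  have ht : ((1 + s) / 2) ^ 2 = (1 + s) / 2 + 1 := by
    field_simp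
    linear_combination -hs
  have hk := key _ ht
  rcases Int.mul_eq_neg_one_iff_eq_one_or_neg_one.1 hk with ⟨h1, h2⟩ | ⟨h1, h2⟩
  · refine ⟨_, ht, key' _ ht, ?_, quadraticChar_neg_one_iff_not_isSquare.1 h2⟩
    by_contra hc
    rw [quadraticChar_neg_one_iff_not_isSquare.2 hc] at h1
    norm_num at h1
  · have ht' : (1 - (1 + s) / 2) ^ 2 = 1 - (1 + s) / 2 + 1 := by linear_combination ht
    refine ⟨1 - (1 + s) / 2, ht', key' _ ht', ?_, ?_⟩
    · by_contra hc
      rw [quadraticChar_neg_one_iff_not_isSquare.2 hc] at h2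
      norm_num at h2
    · rw [sub_sub_cancel]
      exact quadraticChar_neg_one_iff_not_isSquare.1 h1

end Arithmetic

section Distinct
variable {p : ℕ} [Fact p.Prime]

theorem trace_eq_two_of_pow_char {F : Type*} [Field F] [CharP F p] {g : SL(2, F)}
    (h : g ^ p = 1) : g 0 0 + g 1 1 = 2 := by
  have h1 : (g.1 - 1) ^ p = 0 := by
    rw [sub_pow_char_of_commute _ (Commute.one_right _), one_pow,
      ← Matrix.SpecialLinearGroup.coe_pow, h, Matrix.SpecialLinearGroup.coe_one, sub_self]
  have h2 := (Matrix.isNilpotent_trace_of_isNilpotent ⟨p, h1⟩).eq_zero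
  rw [Matrix.trace_sub, Matrix.trace_one, Matrix.trace_fin_two, sub_eq_zero] at h2
  exact_mod_cast h2

theorem exists_trace_eq_two {F : Type*} [Field F] [CharP F p] (hp : Odd p) {g : SL(2, F)}
    (h : pslMk F g ^ p = 1) : ∃ k : SL(2, F), pslMk F k = pslMk F g ∧ k 0 0 + k 1 1 = 2 := by
  rw [← map_pow, pslMk_eq_one] at h
  rcases h with h | h
  · exact ⟨g, rfl, trace_eq_two_of_pow_char h⟩
  · exact ⟨-g, pslMk_neg g, trace_eq_two_of_pow_char (by rw [hp.neg_pow, h, neg_neg])⟩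

/-- `SL(2, p)` is generated by two transvections. -/
theorem sl_closure_eq_top (hp : 5 ≤ p) {L : SL(2, ZMod p)} (h00 : L 0 0 = 1) (h01 : L 0 1 = 0)
    (h10 : L 1 0 = -1) (h11 : L 1 1 = 1) : Subgroup.closure {upperShear 1, L} = ⊤ := by
  have hU : upperShear 1 ∈ Subgroup.closure {upperShear 1, L} := Subgroup.subset_closure (by simp)
  have hL : L ∈ Subgroup.closure {upperShear 1, L} := Subgroup.subset_closure (by simp)
  refine eq_top_of_upperShear_mem (p := p) hp (Or.inl (Nat.card_zmod p)) ?_ one_ne_zero hU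
    ⟨L, hL, by rw [h10]; simp⟩
  have : (upperShear 1 * upperShear 1 * L) ^ 2 = -1 := by
    rw [pow_two]
    apply sl_ext <;> simp only [sl_mul_apply, h00, h01, h10, h11] <;> simp [upperShear]
  rw [← this]
  exact pow_mem (mul_mem (mul_mem hU hU) hL) 2

theorem exists_map_pair_of_mem_closure {G H K : Type*} [Group G] [Group H] [Group K] {f f' : G →* H}
    (π : K →* H) {v w : G} {g h g' h' : K} (hv : f v = π g) (hw : f w = π h) (hv' : f' v = π g')
    (hw' : f' w = π h') {k : K × K} (hk : k ∈ Subgroup.closure {(g, g'), (h, h')}) :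
    ∃ u, f u = π k.1 ∧ f' u = π k.2 := by
  have : Subgroup.closure {(g, g'), (h, h')} ≤ (f.prod f').range.comap (π.prodMap π) := by
    rw [Subgroup.closure_le]
    rintro _ (rfl | rfl)
    · exact ⟨v, Prod.ext hv hv'⟩
    · exact ⟨w, Prod.ext hw hw'⟩
  obtain ⟨u, hu⟩ := this hk
  exact ⟨u, congrArg Prod.fst hu, congrArg Prod.snd hu⟩

/-- Surjections onto `PSL(2, p)` with the same kernel have the same squared traces. -/
theorem sq_trace_eq_of_ker_eq {G : Type*} [Group G] (hp : 5 ≤ p)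
    {f f' : G →* Matrix.ProjectiveSpecialLinearGroup (Fin 2) (ZMod p)}
    (hf : Function.Surjective f) (h : f.ker = f'.ker) {w : G} {g g' : SL(2, ZMod p)}
    (hg : f w = pslMk _ g) (hg' : f' w = pslMk _ g') :
    (g 0 0 + g 1 1) ^ 2 = (g' 0 0 + g' 1 1) ^ 2 := by
  have hodd : Odd p := (Fact.out : p.Prime).odd_of_ne_two (by omega)
  have hker : ∀ u, f u = 1 ↔ f' u = 1 := fun u => by
    rw [← MonoidHom.mem_ker, h, MonoidHom.mem_ker]
  let U : SL(2, ZMod p) := upperShear 1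
  let L : SL(2, ZMod p) := ⟨!![1, 0; -1, 1], by simp⟩
  have tU : U 0 0 + U 1 1 = 2 := by simp [U, upperShear]; norm_num
  have tL : L 0 0 + L 1 1 = 2 := by simp [L]; norm_num
  obtain ⟨w₀, h0⟩ := hf (pslMk _ U)
  obtain ⟨w₁, h1⟩ := hf (pslMk _ L)
  have hpow : ∀ {u : G} {k : SL(2, ZMod p)}, k 0 0 + k 1 1 = 2 → f u = pslMk _ k →
      ∃ k' : SL(2, ZMod p), f' u = pslMk _ k' ∧ k' 0 0 + k' 1 1 = 2 := by
    intro u k hk hu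
    obtain ⟨l, hl⟩ := pslMk_surjective (f' u)
    obtain ⟨k', hk', ht⟩ := exists_trace_eq_two (p := p) hodd (g := l) (by
      rw [hl, ← map_pow, ← hker, map_pow, hu, ← map_pow, sl_pow_char_eq_one hk, map_one])
    exact ⟨k', by rw [hk', hl], ht⟩
  obtain ⟨P, hP, tP⟩ := hpow tU h0
  obtain ⟨Q, hQ, tQ⟩ := hpow tL h1
  have tUUL : (U * U * L) 0 0 + (U * U * L) 1 1 = 0 := by
    simp only [sl_mul_apply]
    simp [U, L, upperShear]
  have tPPQ : (P * P * Q) 0 0 + (P * P * Q) 1 1 = 0 := by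
    have e : f (w₀ * w₀ * w₁) = pslMk _ (U * U * L) := by rw [map_mul, map_mul, h0, h1]; simp
    have e' : f' (w₀ * w₀ * w₁) = pslMk _ (P * P * Q) := by rw [map_mul, map_mul, hP, hQ]; simp
    apply trace_eq_zero_of_pslMk_sq
    · rw [← e', ne_eq, ← hker, e, pslMk_eq_one, sl_eq_one_or_neg_one_iff]
      intro hc
      have := hc.2.1
      simp only [sl_mul_apply] at this
      simp [U, L, upperShear] at this
    · rw [← e', ← map_pow, ← hker, map_pow, e, ← map_pow, pslMk_eq_one]
      right
      have := sl_pow_two_apply (U * U * L)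
      rw [tUUL] at this
      apply sl_ext <;> rw [this] <;> simp
  have tPQ : (P * Q) 0 0 + (P * Q) 1 1 = 1 := by
    have h2 : (2 : ZMod p) ≠ 0 := by
      have h : ((2 : ℕ) : ZMod p) ≠ 0 := by
        rw [ne_eq, ZMod.natCast_eq_zero_iff]
        intro h
        exact absurd (Nat.le_of_dvd two_pos h) (by omega)
      exact_mod_cast h
    have hd := sl_det P
    apply mul_left_cancel₀ h2
    simp only [sl_mul_apply] at tPPQ ⊢
    linear_combination tPPQ + (Q 0 0 + Q 1 1) * hd + tQ -
      (P 0 0 * Q 0 0 + P 0 1 * Q 1 0 + P 1 0 * Q 0 1 + P 1 1 * Q 1 1) * tP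
  have H : SameTraces (RingHom.id (ZMod p)) U L P Q := by
    refine ⟨tP.trans tU.symm, tQ.trans tL.symm, tPQ.trans ?_⟩
    simp only [sl_mul_apply]
    simp [U, L, upperShear]
  have htop := sl_closure_eq_top hp (L := L) rfl rfl rfl rfl
  have hmap : (Subgroup.closure {(U, P), (L, Q)}).map (MonoidHom.fst _ _) = ⊤ := by
    rw [MonoidHom.map_closure, Set.image_pair]
    exact htop
  obtain ⟨⟨_, k⟩, hk, rfl⟩ : g ∈ (Subgroup.closure {(U, P), (L, Q)}).map (MonoidHom.fst _ _) := by
    rw [hmap]; trivial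
  obtain ⟨u, hu, hu'⟩ := exists_map_pair_of_mem_closure (pslMk _) h0 h1 hP hQ hk
  have hw : f' w = f' u := by
    rw [← mul_inv_eq_one, ← map_inv, ← map_mul, ← hker, map_mul, map_inv, mul_inv_eq_one, hg, hu]
    rfl
  have ht := (SameCoords.of_mem_closure H (by
    rintro _ (rfl | rfl)
    · exact SameCoords.left
    · exact SameCoords.right) hk).trace_eq H
  rw [Matrix.trace_fin_two, Matrix.trace_fin_two] at ht
  rw [hg', hu', pslMk_eq_iff] at hw
  have e : (g' 0 0 + g' 1 1) ^ 2 = (k 0 0 + k 1 1) ^ 2 := by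
    rcases hw with rfl | rfl
    · rfl
    · rw [Matrix.SpecialLinearGroup.coe_neg, Matrix.neg_apply, Matrix.neg_apply]
      ring
  rw [e]
  exact congrArg (· ^ 2) ht.symm

end Distinct

section Counting
variable {p : ℕ} [Fact p.Prime]

theorem eq_or_eq_one_sub_of_golden {F : Type*} [Field F] {τ τ' : F} (h : τ ^ 2 = τ + 1)
    (h' : τ' ^ 2 = τ' + 1) : τ' = τ ∨ τ' = 1 - τ := by
  have : (τ' - τ) * (τ' - (1 - τ)) = 0 := by linear_combination h' - h
  exact (mul_eq_zero.1 this).imp sub_eq_zero.1 sub_eq_zero.1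

theorem eq_or_eq_of_sq {F : Type*} [Field F] (h2 : (2 : F) ≠ 0) {τ r x : F}
    (hr : r ^ 2 = 5 - 4 * τ) (hx : x ^ 2 - x + τ - 1 = 0) :
    x = (1 + r) / 2 ∨ x = 1 - (1 + r) / 2 := by
  have : (x - (1 + r) / 2) * (x - (1 - (1 + r) / 2)) = 0 := by
    field_simp
    linear_combination 4 * hx - hr
  exact (mul_eq_zero.1 this).imp sub_eq_zero.1 sub_eq_zero.1

theorem root_of_sq {F : Type*} [Field F] (h2 : (2 : F) ≠ 0) {τ r : F}
    (hr : r ^ 2 = 5 - 4 * τ) : ((1 + r) / 2) ^ 2 - (1 + r) / 2 + τ - 1 = 0 := by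
  field_simp
  linear_combination hr

theorem natCast_ne_zero_of_lt {F : Type*} [Field F] {p : ℕ} [CharP F p] {n : ℕ} (h0 : 0 < n)
    (hn : n < p) :
    (n : F) ≠ 0 := fun h =>
  absurd (Nat.le_of_dvd h0 ((CharP.cast_eq_zero_iff F p n).1 h)) (by omega)

theorem ncard_psl_prime (hp : 7 ≤ p) {τ : ZMod p} (ht : τ ^ 2 = τ + 1) (h0 : 5 - 4 * τ ≠ 0)
    (hs : IsSquare (5 - 4 * τ)) (hs' : ¬ IsSquare (5 - 4 * (1 - τ))) :
    {K : Subgroup Tet | IsPSLQuotient (ZMod p) K}.ncard = 2 := by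
  have h2 : (2 : ZMod p) ≠ 0 := by
    exact_mod_cast natCast_ne_zero_of_lt (p := p) (F := ZMod p) two_pos (by omega)
  have h3 : (3 : ZMod p) ≠ 0 := by
    exact_mod_cast natCast_ne_zero_of_lt (p := p) (F := ZMod p) three_pos (by omega)
  obtain ⟨r, hr⟩ := hs
  rw [← pow_two] at hr
  have hr0 : r ≠ 0 := by
    rintro rfl
    exact h0 (by rw [hr]; simp)
  have hx := root_of_sq h2 hr.symm
  set x := (1 + r) / 2 with hxr
  have hx' : (1 - x) ^ 2 - (1 - x) + τ - 1 = 0 := by linear_combination hx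
  obtain ⟨A₁, B₁, C₁, T₁⟩ := exists_tetTriple_of_root h2 h3 ht hx
  obtain ⟨A₂, B₂, C₂, T₂⟩ := exists_tetTriple_of_root h2 h3 ht hx'
  obtain ⟨f₁, hf₁⟩ := T₁.exists_lift
  obtain ⟨f₂, hf₂⟩ := T₂.exists_lift
  have hc : Nat.card (ZMod p) = p := Nat.card_zmod p
  have s₁ := hf₁.surjective fun G => T₁.generates hp (Or.inl hc)
  have s₂ := hf₂.surjective fun G => T₂.generates hp (Or.inl hc)
  rw [Set.ncard_eq_two]
  refine ⟨f₁.ker, f₂.ker, ?_, ?_⟩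
  · intro hk
    have := sq_trace_eq_of_ker_eq (by omega) s₁ hk (w := .of 0 * .of 2) (g := A₁ * C₁)
      (g' := A₂ * C₂) (by rw [map_mul, map_mul, hf₁.map_zero, hf₁.map_two])
      (by rw [map_mul, map_mul, hf₂.map_zero, hf₂.map_two])
    rw [T₁.trAC, T₂.trAC] at this
    apply hr0
    have e : 2 * x = 1 + r := by rw [hxr]; field_simp
    linear_combination this - e
  · ext K
    constructor
    · rintro ⟨f, hf, rfl⟩
      obtain ⟨τ', x', A, B, C, T, hl⟩ := exists_tetTriple f (ne_one_of_surjective hf)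
      have hfr := T.fricke
      rcases eq_or_eq_one_sub_of_golden ht T.tau with rfl | rfl
      · rcases eq_or_eq_of_sq h2 hr.symm hfr with rfl | rfl
        · exact Or.inl (T.ker_eq (σ := RingHom.id _) T₁ hl hf₁)
        · exact Or.inr (T.ker_eq (σ := RingHom.id _) T₂ hl hf₂)
      · exact absurd ⟨2 * x' - 1, by linear_combination -4 * hfr⟩ hs'
    · rintro (rfl | rfl)
      · exact ⟨f₁, s₁, rfl⟩
      · exact ⟨f₂, s₂, rfl⟩

/-- A triple all of whose traces come from `F` does not give a surjection onto `PSL(2, F')` for a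
larger field `F'`. -/
theorem TetTriple.surjective_of_lift {F F' : Type*} [Field F] [Field F'] {σ : F →+* F'} {τ x : F}
    {A B C : SL(2, F)} {A' B' C' : SL(2, F')} (T : TetTriple τ x A B C)
    (T' : TetTriple (σ τ) (σ x) A' B' C')
    {f : Tet →* Matrix.ProjectiveSpecialLinearGroup (Fin 2) F'} (hf : TetLift f A' B' C')
    (hs : Function.Surjective f) : Function.Surjective σ := by
  intro t
  let k : SL(2, F') := ⟨!![t, -1; 1, 0], by simp⟩
  have tk : k 0 0 + k 1 1 = t := add_zero t
  obtain ⟨f₀, hf₀⟩ := T.exists_lift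
  obtain ⟨w, hw⟩ := hs (pslMk F' k)
  obtain ⟨g, hg, -, h⟩ := hf₀.exists_mem_closure hf w
  have ht := (T.sameCoords T' hg).trace_eq (T.sameTraces T')
  rw [Matrix.trace_fin_two, Matrix.trace_fin_two] at ht
  rw [hw, pslMk_eq_iff] at h
  rcases h with h | h
  · exact ⟨_, by rw [← ht, ← tk, h]⟩
  · refine ⟨-(g.1 0 0 + g.1 1 1), ?_⟩
    rw [map_neg, ← ht, ← tk, h, Matrix.SpecialLinearGroup.coe_neg, Matrix.neg_apply,
      Matrix.neg_apply]
    ring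

theorem exists_sqrt_galoisField (hp : Odd p) {d : ZMod p} (hd : ¬ IsSquare d) :
    ∃ r : GaloisField p 2, r ^ 2 = algebraMap _ _ d ∧ r ^ p = -r ∧ r ≠ 0 := by
  have hp2 : p ≠ 2 := by rintro rfl; exact absurd hp (by decide)
  have := Fintype.ofFinite (GaloisField p 2)
  have hcard : Fintype.card (GaloisField p 2) = p ^ 2 := by
    rw [← Nat.card_eq_fintype_card, GaloisField.card p 2 two_ne_zero]
  have hd0 : d ≠ 0 := by rintro rfl; exact hd IsSquare.zero
  have hc : ringChar (GaloisField p 2) ≠ 2 := by rwa [ringChar.eq (GaloisField p 2) p]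
  have hc' : ringChar (ZMod p) ≠ 2 := by rwa [ringChar.eq (ZMod p) p]
  have hφ0 : algebraMap (ZMod p) (GaloisField p 2) d ≠ 0 := by simpa using hd0
  obtain ⟨m, hm⟩ := hp
  obtain ⟨r, hr⟩ := (FiniteField.isSquare_iff hc hφ0).2 (by
    have e : Fintype.card (GaloisField p 2) / 2 = (p - 1) * (m + 1) := by
      rw [hcard, hm, Nat.add_sub_cancel]
      have : (2 * m + 1) ^ 2 = 2 * (2 * m * (m + 1)) + 1 := by ring
      omega
    rw [e, pow_mul, ← map_pow, ZMod.pow_card_sub_one_eq_one hd0, map_one, one_pow])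
  rw [← pow_two] at hr
  have hr0 : r ≠ 0 := by rintro rfl; exact hφ0 (by simp [hr])
  refine ⟨r, hr.symm, ?_, hr0⟩
  have h1 : (r ^ p) ^ 2 = r ^ 2 := by
    rw [← pow_mul, mul_comm, pow_mul, ← hr, ← map_pow, ZMod.pow_card]
  refine (sq_eq_sq_iff_eq_or_eq_neg.1 h1).resolve_left fun h => hd ?_
  rw [FiniteField.isSquare_iff hc' hd0, ZMod.card]
  apply (algebraMap (ZMod p) (GaloisField p 2)).injective
  rw [map_pow, hr, map_one, ← pow_mul, show 2 * (p / 2) = p - 1 by omega]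
  apply mul_left_cancel₀ hr0
  rw [← pow_succ', mul_one, Nat.sub_add_cancel (by omega), h]

theorem existsUnique_psl_prime_sq (hp : 7 ≤ p) {τ : ZMod p} (ht : τ ^ 2 = τ + 1)
    (hs : IsSquare (5 - 4 * τ)) (hs' : ¬ IsSquare (5 - 4 * (1 - τ))) :
    ∃! K : Subgroup Tet, IsPSLQuotient (GaloisField p 2) K := by
  let φ := algebraMap (ZMod p) (GaloisField p 2)
  have h2 : (2 : GaloisField p 2) ≠ 0 := by
    exact_mod_cast natCast_ne_zero_of_lt (p := p) (F := GaloisField p 2) two_pos (by omega)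
  have h3 : (3 : GaloisField p 2) ≠ 0 := by
    exact_mod_cast natCast_ne_zero_of_lt (p := p) (F := GaloisField p 2) three_pos (by omega)
  have h2' : (2 : ZMod p) ≠ 0 := by
    exact_mod_cast natCast_ne_zero_of_lt (p := p) (F := ZMod p) two_pos (by omega)
  have h3' : (3 : ZMod p) ≠ 0 := by
    exact_mod_cast natCast_ne_zero_of_lt (p := p) (F := ZMod p) three_pos (by omega)
  have hodd : Odd p := (Fact.out : p.Prime).odd_of_ne_two (by omega)
  have hcard : Nat.card (GaloisField p 2) = p ^ 2 := GaloisField.card p 2 two_ne_zero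
  obtain ⟨r, hr, hrp, hr0⟩ := exists_sqrt_galoisField hodd hs'
  have hr' : r ^ 2 = 5 - 4 * φ (1 - τ) := by
    rw [hr, map_sub, map_mul, map_ofNat, map_ofNat]
  have htφ : φ (1 - τ) ^ 2 = φ (1 - τ) + 1 := by
    rw [← map_pow, ← map_one φ, ← map_add]
    congr 1
    linear_combination ht
  have hx := root_of_sq h2 hr'
  have hfx : frobenius (GaloisField p 2) p ((1 + r) / 2) = 1 - (1 + r) / 2 := by
    rw [map_div₀, map_add, map_one, map_ofNat, frobenius_def, hrp]
    field_simp
    ring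
  set x := (1 + r) / 2 with hxr
  have hfτ : frobenius (GaloisField p 2) p (φ (1 - τ)) = φ (1 - τ) := by
    rw [frobenius_def, ← map_pow, ZMod.pow_card]
  obtain ⟨A₁, B₁, C₁, T₁⟩ := exists_tetTriple_of_root h2 h3 htφ hx
  obtain ⟨f₁, hf₁⟩ := T₁.exists_lift
  have s₁ := hf₁.surjective fun G => T₁.generates hp (Or.inr ⟨hcard, by
    rw [← frobenius_def, map_pow, hfx]
    intro h
    have e : 2 * x = 1 + r := by rw [hxr]; field_simp
    exact hr0 (by linear_combination -h - e)⟩)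
  refine ⟨f₁.ker, ⟨f₁, s₁, rfl⟩, ?_⟩
  rintro _ ⟨f, hf, rfl⟩
  obtain ⟨τ', x', A, B, C, T, hl⟩ := exists_tetTriple f (ne_one_of_surjective hf)
  have hfr := T.fricke
  rcases eq_or_eq_one_sub_of_golden htφ T.tau with rfl | rfl
  · rcases eq_or_eq_of_sq h2 hr' hfr with h | h
    · rw [← hxr] at h
      rw [h] at T
      exact T.ker_eq (σ := RingHom.id _) T₁ hl hf₁
    · rw [← hxr] at h
      rw [h, ← hfτ, ← hfx] at T
      exact (T₁.ker_eq T hf₁ hl).symm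
  · exfalso
    have e : 1 - φ (1 - τ) = φ τ := by rw [map_sub, map_one, sub_sub_cancel]
    rw [e] at T hfr
    obtain ⟨s, hs⟩ := hs
    rw [← pow_two] at hs
    have hsφ : φ s ^ 2 = 5 - 4 * φ τ := by
      rw [← map_pow, ← hs, map_sub, map_mul, map_ofNat, map_ofNat]
    have hy := root_of_sq h2' hs.symm
    obtain ⟨y, hy, rfl⟩ : ∃ y, y ^ 2 - y + τ - 1 = 0 ∧ φ y = x' := by
      rcases eq_or_eq_of_sq h2 hsφ hfr with h | h
      · exact ⟨_, hy, by rw [h, map_div₀, map_add, map_one, map_ofNat]⟩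
      · exact ⟨1 - (1 + s) / 2, by linear_combination hy, by
          rw [h, map_sub, map_div₀, map_add, map_one, map_ofNat]⟩
    obtain ⟨A₂, B₂, C₂, T₂⟩ := exists_tetTriple_of_root h2' h3' ht hy
    have hle := Nat.card_le_card_of_surjective φ (T₂.surjective_of_lift T hl hf)
    rw [hcard, Nat.card_zmod] at hle
    nlinarith

end Counting

theorem stmt_4 (p : ℕ) [Fact p.Prime]
    (h5 : p % 5 = 1 ∨ p % 5 = 4)
    (h11 : p % 11 = 2 ∨ p % 11 = 6 ∨ p % 11 = 7 ∨ p % 11 = 8 ∨ p % 11 = 10) :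
    {K : Subgroup Tet | IsPSLQuotient (ZMod p) K}.ncard = 2 ∧
    (∃! K : Subgroup Tet, IsPSLQuotient (GaloisField p 2) K) := by
  have hp : 7 ≤ p := by
    have := (Fact.out : p.Prime)
    by_contra! h
    interval_cases p <;> first | omega | exact absurd this (by norm_num)
  obtain ⟨τ, ht, h0, hs, hs'⟩ := exists_golden_root h5 h11
  exact ⟨ncard_psl_prime hp ht h0 hs hs', existsUnique_psl_prime_sq hp ht hs hs'⟩
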